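/- Consider site percolation on ℤ² with parameter p satisfying p_c < p ≤ 1. Let A_n be the event that there is an open left-right crossing of the box {0,…,n} × {0,…,n}, i.e. a path of adjacent open sites inside the box joining some site in the column {0} × {0,…,n} to some site in the column {n} × {0,…,n}. Then there exists a constant C₄ = C₄(p) > 0 such that for all integers n ≥ 1, P_p(A_n) ≥ 1 − n·exp(−C₄·n). -/

import Mathlib

open MeasureTheory
open scoped ENNReal

/-- Configurations of site percolation on `ℤ²`: `true` = open (black). -/
abbrev Config : Type := ℤ × ℤ → Bool

/-- Two sites of `ℤ²` are adjacent iff `|v₁ − w₁| + |v₂ − w₂| = 1`. -/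
def Adjacent (v w : ℤ × ℤ) : Prop := |v.1 - w.1| + |v.2 - w.2| = 1

/-- `OpenConn ω S v w` : there is a path of adjacent open sites staying in `S`
joining `v` to `w` (in the configuration `ω`). -/
def OpenConn (ω : Config) (S : Set (ℤ × ℤ)) : ℤ × ℤ → ℤ × ℤ → Prop :=
  Relation.ReflTransGen fun a b => Adjacent a b ∧ b ∈ S ∧ ω b = true

/-- The open cluster of the site `v` within the region `S`, in the configuration `ω`:
the set of open sites of `S` joined to `v` by a path of adjacent open sites staying in
`S`. It is empty if `v` is closed or `v ∉ S`. -/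
def cluster (ω : Config) (S : Set (ℤ × ℤ)) (v : ℤ × ℤ) : Set (ℤ × ℤ) :=
  {w | v ∈ S ∧ ω v = true ∧ OpenConn ω S v w}

/-- `IsBernoulliProduct p μ` : `μ` is the product measure on configurations under which
each site of `ℤ²` is independently open with probability `p`. -/
def IsBernoulliProduct (p : ℝ) (μ : Measure Config) : Prop :=
  IsProbabilityMeasure μ ∧
    ∀ (s : Finset (ℤ × ℤ)) (f : (ℤ × ℤ) → Bool),
      μ {ω | ∀ v ∈ s, ω v = f v} =
        ∏ v ∈ s, ENNReal.ofReal (if f v then p else 1 - p)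

/-- The critical probability `p_c` of site percolation on `ℤ²`:
`p_c = sSup {p ∈ [0,1] : P_p(|C(0,0)| = ∞) = 0}`. -/
noncomputable def siteCriticalProbability : ℝ :=
  sSup {p : ℝ | p ∈ Set.Icc (0 : ℝ) 1 ∧
    ∀ μ : Measure Config, IsBernoulliProduct p μ →
      μ {ω | (cluster ω Set.univ (0, 0)).Infinite} = 0}

/-- The `N × N` box `{1,…,N} × {1,…,N}` in `ℤ²` (the pixel screen). -/
def box (N : ℕ) : Set (ℤ × ℤ) :=
  {v | 1 ≤ v.1 ∧ v.1 ≤ (N : ℤ) ∧ 1 ≤ v.2 ∧ v.2 ≤ (N : ℤ)}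

/-- The box `{0,…,n} × {0,…,n}` in `ℤ²`. -/
def box0 (n : ℕ) : Set (ℤ × ℤ) :=
  {v | 0 ≤ v.1 ∧ v.1 ≤ (n : ℤ) ∧ 0 ≤ v.2 ∧ v.2 ≤ (n : ℤ)}

/-- The event that there is an open left-right crossing of the box `{0,…,n} × {0,…,n}`:
a path of adjacent open sites inside the box joining some site of the column
`{0} × {0,…,n}` to some site of the column `{n} × {0,…,n}`. -/
def CrossingEvent (n : ℕ) : Set Config :=
  {ω | ∃ v ∈ box0 n, v.1 = 0 ∧ ω v = true ∧
    ∃ w ∈ box0 n, w.1 = (n : ℤ) ∧ OpenConn ω (box0 n) v w}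

set_option autoImplicit false

namespace Perc

section Expect
variable {V : Type*} [DecidableEq V]

/-- Real-valued indicator of a proposition. -/
noncomputable def ind (P : Prop) : ℝ := by classical exact if P then 1 else 0

lemma ind_true {P : Prop} (h : P) : ind P = 1 := by simp [ind, h]
lemma ind_false {P : Prop} (h : ¬ P) : ind P = 0 := by simp [ind, h]
lemma ind_nonneg (P : Prop) : 0 ≤ ind P := by
  by_cases h : P
  · rw [ind_true h]; norm_num
  · rw [ind_false h]
lemma ind_le_one (P : Prop) : ind P ≤ 1 := by
  by_cases h : P
  · rw [ind_true h]
  · rw [ind_false h]; norm_num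
lemma ind_mono {P Q : Prop} (h : P → Q) : ind P ≤ ind Q := by
  by_cases hP : P
  · rw [ind_true hP, ind_true (h hP)]
  · rw [ind_false hP]; exact ind_nonneg Q
lemma ind_congr {P Q : Prop} (h : P ↔ Q) : ind P = ind Q := by
  rw [propext h]
lemma ind_not (P : Prop) : ind (¬ P) = 1 - ind P := by
  by_cases h : P
  · rw [ind_true h, ind_false (by simpa using h)]; norm_num
  · rw [ind_false h, ind_true h]; norm_num
lemma ind_and (P Q : Prop) : ind (P ∧ Q) = ind P * ind Q := by
  by_cases hP : P <;> by_cases hQ : Q <;> simp [ind, hP, hQ]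

/-- Expectation of `f` of the random set of occupied sites in `Λ`. -/
noncomputable def EE (p : ℝ) (Λ : Finset V) (f : Finset V → ℝ) : ℝ :=
  ∑ T ∈ Λ.powerset, p ^ T.card * (1 - p) ^ (Λ \ T).card * f T

/-- Probability of an event. -/
noncomputable def PP (p : ℝ) (Λ : Finset V) (P : Finset V → Prop) : ℝ :=
  EE p Λ (fun T => ind (P T))

lemma EE_empty (p : ℝ) (f : Finset V → ℝ) : EE p ∅ f = f ∅ := by simp [EE]

lemma EE_insert (p : ℝ) {Λ : Finset V} {v : V} (hv : v ∉ Λ) (f : Finset V → ℝ) :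
    EE p (insert v Λ) f =
      p * EE p Λ (fun T => f (insert v T)) + (1 - p) * EE p Λ f := by
  unfold EE
  rw [Finset.sum_powerset_insert hv, add_comm, Finset.mul_sum, Finset.mul_sum]
  congr 1
  · apply Finset.sum_congr rfl
    intro T hT
    rw [Finset.mem_powerset] at hT
    have h1 : v ∉ T := fun h => hv (hT h)
    have h2 : insert v Λ \ insert v T = Λ \ T := by
      ext x; simp only [Finset.mem_sdiff, Finset.mem_insert]
      constructor
      · rintro ⟨h | h, h'⟩
        · exact absurd (Or.inl h) h'
        · exact ⟨h, fun h3 => h' (Or.inr h3)⟩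
      · rintro ⟨h, h'⟩
        refine ⟨Or.inr h, ?_⟩
        rintro (h3 | h3)
        · exact hv (h3 ▸ h)
        · exact h' h3
    rw [h2, Finset.card_insert_of_notMem h1]
    ring
  · apply Finset.sum_congr rfl
    intro T hT
    rw [Finset.mem_powerset] at hT
    have h1 : v ∉ T := fun h => hv (hT h)
    rw [Finset.insert_sdiff_of_notMem _ h1, Finset.card_insert_of_notMem (by simp [hv])]
    ring

lemma EE_congr (p : ℝ) {Λ : Finset V} {f g : Finset V → ℝ} (h : ∀ T, T ⊆ Λ → f T = g T) :
    EE p Λ f = EE p Λ g := by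
  unfold EE
  apply Finset.sum_congr rfl
  intro T hT
  rw [h T (Finset.mem_powerset.1 hT)]

lemma EE_mono {p : ℝ} (h0 : 0 ≤ p) (h1 : p ≤ 1) {Λ : Finset V} {f g : Finset V → ℝ}
    (h : ∀ T, T ⊆ Λ → f T ≤ g T) : EE p Λ f ≤ EE p Λ g := by
  unfold EE
  apply Finset.sum_le_sum
  intro T hT
  have : (0:ℝ) ≤ 1 - p := by linarith
  exact mul_le_mul_of_nonneg_left (h T (Finset.mem_powerset.1 hT)) (by positivity)

lemma EE_add (p : ℝ) (Λ : Finset V) (f g : Finset V → ℝ) :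
    EE p Λ (fun T => f T + g T) = EE p Λ f + EE p Λ g := by
  unfold EE
  rw [← Finset.sum_add_distrib]
  exact Finset.sum_congr rfl fun T _ => by ring

lemma EE_sub (p : ℝ) (Λ : Finset V) (f g : Finset V → ℝ) :
    EE p Λ (fun T => f T - g T) = EE p Λ f - EE p Λ g := by
  unfold EE
  rw [← Finset.sum_sub_distrib]
  exact Finset.sum_congr rfl fun T _ => by ring

lemma EE_const_mul (p : ℝ) (Λ : Finset V) (c : ℝ) (f : Finset V → ℝ) :
    EE p Λ (fun T => c * f T) = c * EE p Λ f := by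
  unfold EE
  rw [Finset.mul_sum]
  exact Finset.sum_congr rfl fun T _ => by ring

lemma EE_mul_const (p : ℝ) (Λ : Finset V) (c : ℝ) (f : Finset V → ℝ) :
    EE p Λ (fun T => f T * c) = EE p Λ f * c := by
  unfold EE
  rw [Finset.sum_mul]
  exact Finset.sum_congr rfl fun T _ => by ring

lemma EE_const (p : ℝ) (Λ : Finset V) (c : ℝ) : EE p Λ (fun _ => c) = c := by
  induction Λ using Finset.induction_on with
  | empty => exact EE_empty _ _
  | insert v Λ hv ih => rw [EE_insert p hv, ih]; ring

lemma EE_sum {ι : Type*} (p : ℝ) (Λ : Finset V) (s : Finset ι) (f : ι → Finset V → ℝ) :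
    EE p Λ (fun T => ∑ i ∈ s, f i T) = ∑ i ∈ s, EE p Λ (f i) := by
  unfold EE
  rw [Finset.sum_comm]
  exact Finset.sum_congr rfl fun T _ => by rw [Finset.mul_sum]

lemma EE_nonneg {p : ℝ} (h0 : 0 ≤ p) (h1 : p ≤ 1) {Λ : Finset V} {f : Finset V → ℝ}
    (h : ∀ T, T ⊆ Λ → 0 ≤ f T) : 0 ≤ EE p Λ f := by
  have := EE_mono h0 h1 (Λ := Λ) (f := fun _ => 0) (g := f) h
  rwa [EE_const] at this

lemma EE_union (p : ℝ) (A B : Finset V) (hAB : Disjoint A B) (f : Finset V → ℝ) :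
    EE p (A ∪ B) f = EE p A (fun S => EE p B (fun S' => f (S ∪ S'))) := by
  induction A using Finset.induction_on generalizing f with
  | empty => simp [EE_empty]
  | insert v A hv ih =>
    rw [Finset.disjoint_insert_left] at hAB
    rw [Finset.insert_union, EE_insert p (by simp [hv, hAB.1]), EE_insert p hv,
      ih hAB.2, ih hAB.2]
    simp only [Finset.insert_union]

lemma EE_marg (p : ℝ) {A Λ : Finset V} (hA : A ⊆ Λ) (f : Finset V → ℝ) :
    EE p Λ (fun T => f (T ∩ A)) = EE p A f := by
  have hd : Disjoint A (Λ \ A) := Finset.disjoint_sdiff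
  conv_lhs => rw [← Finset.union_sdiff_of_subset hA]
  rw [EE_union p A (Λ \ A) hd]
  apply EE_congr
  intro S hS
  rw [EE_congr p (g := fun _ => f S), EE_const]
  intro S' hS'
  congr 1
  ext x
  simp only [Finset.mem_inter, Finset.mem_union]
  constructor
  · rintro ⟨h | h, h2⟩
    · exact h
    · exact absurd h2 (Finset.mem_sdiff.1 (hS' h)).2
  · exact fun h => ⟨Or.inl h, hS h⟩

lemma EE_indep (p : ℝ) {A Λ : Finset V} (hA : A ⊆ Λ) (f g : Finset V → ℝ) :
    EE p Λ (fun T => f (T ∩ A) * g (T \ A)) = EE p A f * EE p (Λ \ A) g := by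
  have hd : Disjoint A (Λ \ A) := Finset.disjoint_sdiff
  conv_lhs => rw [← Finset.union_sdiff_of_subset hA]
  rw [EE_union p A (Λ \ A) hd, ← EE_mul_const]
  apply EE_congr
  intro S hS
  rw [← EE_const_mul]
  apply EE_congr
  intro S' hS'
  have h1 : (S ∪ S') ∩ A = S := by
    ext x
    simp only [Finset.mem_inter, Finset.mem_union]
    constructor
    · rintro ⟨h | h, h2⟩
      · exact h
      · exact absurd h2 (Finset.mem_sdiff.1 (hS' h)).2
    · exact fun h => ⟨Or.inl h, hS h⟩
  have h2 : (S ∪ S') \ A = S' := by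
    ext x
    simp only [Finset.mem_sdiff, Finset.mem_union]
    constructor
    · rintro ⟨h | h, h2⟩
      · exact absurd (hS h) h2
      · exact h
    · exact fun h => ⟨Or.inr h, (Finset.mem_sdiff.1 (hS' h)).2⟩
  rw [h1, h2]

lemma EE_marg' (p : ℝ) (A Λ : Finset V) (f : Finset V → ℝ) :
    EE p Λ (fun T => f (T \ A)) = EE p (Λ \ A) f := by
  rw [← EE_marg p (Finset.sdiff_subset (s := Λ) (t := A)) f]
  apply EE_congr
  intro T hT
  congr 1
  ext x
  simp only [Finset.mem_sdiff, Finset.mem_inter]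
  exact ⟨fun h => ⟨h.1, hT h.1, h.2⟩, fun h => ⟨h.1, h.2.2⟩⟩

lemma EE_map (p : ℝ) (σ : V ≃ V) (Λ : Finset V) (f : Finset V → ℝ) :
    EE p (Λ.map σ.toEmbedding) f = EE p Λ (fun T => f (T.map σ.toEmbedding)) := by
  induction Λ using Finset.induction_on generalizing f with
  | empty => simp [EE_empty]
  | insert v Λ hv ih =>
    rw [Finset.map_insert, EE_insert p (by simpa using hv), EE_insert p hv, ih, ih]
    simp only [Finset.map_insert]

lemma EE_compl (p : ℝ) (Λ : Finset V) (f : Finset V → ℝ) :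
    EE p Λ (fun T => f (Λ \ T)) = EE (1 - p) Λ f := by
  unfold EE
  refine Finset.sum_nbij' (fun T => Λ \ T) (fun T => Λ \ T) ?_ ?_ ?_ ?_ ?_
  · intro T _; simp
  · intro T _; simp
  · intro T hT; simpa using Finset.mem_powerset.1 hT
  · intro T hT; simpa using Finset.mem_powerset.1 hT
  · intro T hT
    have := Finset.mem_powerset.1 hT
    simp only [Finset.sdiff_sdiff_eq_self this]
    ring

lemma EE_hasDeriv (p : ℝ) (Λ : Finset V) (f : Finset V → ℝ) :
    HasDerivAt (fun p => EE p Λ f)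
      (∑ v ∈ Λ, EE p Λ (fun T => f (insert v T) - f (T.erase v))) p := by
  induction Λ using Finset.induction_on generalizing f with
  | empty =>
    simp only [EE_empty, Finset.sum_empty]
    exact hasDerivAt_const p _
  | insert v Λ hv ih =>
    have hfun : (fun p => EE p (insert v Λ) f) =
        fun p => p * EE p Λ (fun T => f (insert v T)) + (1 - p) * EE p Λ f := by
      funext p; exact EE_insert p hv f
    rw [hfun]
    have h1 := (hasDerivAt_id p).mul (ih (fun T => f (insert v T)))
    have h2 := ((hasDerivAt_const p (1:ℝ)).sub (hasDerivAt_id p)).mul (ih f)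
    refine (h1.add h2).congr_deriv (Eq.symm ?_)
    rw [Finset.sum_insert hv]
    have e1 : EE p (insert v Λ) (fun T => f (insert v T) - f (T.erase v)) =
        EE p Λ (fun T => f (insert v T)) - EE p Λ f := by
      rw [EE_insert p hv]
      have a1 : EE p Λ (fun T => f (insert v (insert v T)) - f ((insert v T).erase v)) =
          EE p Λ (fun T => f (insert v T)) - EE p Λ f := by
        rw [← EE_sub]
        apply EE_congr
        intro T hT
        rw [Finset.insert_idem, Finset.erase_insert (fun h => hv (hT h))]
      have a2 : EE p Λ (fun T => f (insert v T) - f (T.erase v)) =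
          EE p Λ (fun T => f (insert v T)) - EE p Λ f := by
        rw [← EE_sub]
        apply EE_congr
        intro T hT
        rw [Finset.erase_eq_of_notMem (fun h => hv (hT h))]
      rw [a1, a2]; ring
    have e2 : ∀ u ∈ Λ, EE p (insert v Λ) (fun T => f (insert u T) - f (T.erase u)) =
        p * EE p Λ (fun T => f (insert v (insert u T)) - f (insert v (T.erase u))) +
        (1 - p) * EE p Λ (fun T => f (insert u T) - f (T.erase u)) := by
      intro u hu
      rw [EE_insert p hv]
      congr 2
      apply EE_congr
      intro T hT
      have huv : u ≠ v := fun h => hv (h ▸ hu)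
      rw [Finset.insert_comm, Finset.erase_insert_of_ne huv.symm]
    rw [e1, Finset.sum_congr rfl e2, Finset.sum_add_distrib, ← Finset.mul_sum, ← Finset.mul_sum]
    simp only [id, Pi.sub_apply]
    ring

lemma EE_harris {p : ℝ} (h0 : 0 ≤ p) (h1 : p ≤ 1) (Λ : Finset V) {f g : Finset V → ℝ}
    (hf : Antitone f) (hg : Antitone g) :
    EE p Λ f * EE p Λ g ≤ EE p Λ (fun T => f T * g T) := by
  induction Λ using Finset.induction_on generalizing f g with
  | empty => simp [EE_empty]
  | insert v Λ hv ih =>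
    rw [EE_insert p hv, EE_insert p hv, EE_insert p hv]
    have hins : Monotone (fun T : Finset V => insert v T) :=
      fun _ _ h => Finset.insert_subset_insert v h
    have i1 := ih (hf.comp_monotone hins) (hg.comp_monotone hins)
    have i0 := ih hf hg
    simp only [Function.comp_def] at i1
    have m1 : EE p Λ (fun T => f (insert v T)) ≤ EE p Λ f :=
      EE_mono h0 h1 fun T _ => hf (Finset.subset_insert v T)
    have m2 : EE p Λ (fun T => g (insert v T)) ≤ EE p Λ g :=
      EE_mono h0 h1 fun T _ => hg (Finset.subset_insert v T)
    have q0 : 0 ≤ 1 - p := by linarith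
    have j1 := mul_le_mul_of_nonneg_left i1 h0
    have j0 := mul_le_mul_of_nonneg_left i0 q0
    have k := mul_nonneg (mul_nonneg h0 q0)
      (mul_nonneg (sub_nonneg.2 m1) (sub_nonneg.2 m2))
    nlinarith [j1, j0, k]

lemma EE_mono_p {p q : ℝ} (h0 : 0 ≤ p) (hpq : p ≤ q) (h1 : q ≤ 1) (Λ : Finset V)
    {f : Finset V → ℝ} (hf : Monotone f) : EE p Λ f ≤ EE q Λ f := by
  induction Λ using Finset.induction_on generalizing f with
  | empty => simp [EE_empty]
  | insert v Λ hv ih =>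
    rw [EE_insert p hv, EE_insert q hv]
    have hins : Monotone (fun T : Finset V => insert v T) :=
      fun _ _ h => Finset.insert_subset_insert v h
    have i1 := ih (hf.comp hins)
    have i0 := ih hf
    simp only [Function.comp_def] at i1
    have m1 : EE q Λ f ≤ EE q Λ (fun T => f (insert v T)) :=
      EE_mono (h0.trans hpq) h1 fun T _ => hf (Finset.subset_insert v T)
    have a := mul_le_mul_of_nonneg_left i1 h0
    have b := mul_le_mul_of_nonneg_left i0 (by linarith : (0:ℝ) ≤ 1 - p)
    have c := mul_nonneg (sub_nonneg.2 hpq) (sub_nonneg.2 m1)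
    nlinarith [a, b, c]

lemma EE_insert_le {p : ℝ} (h0 : 0 < p) (h1 : p ≤ 1) {Λ : Finset V} {v : V} (hv : v ∈ Λ)
    {g : Finset V → ℝ} (hg : ∀ T, 0 ≤ g T) :
    EE p Λ (fun T => g (insert v T)) ≤ p⁻¹ * EE p Λ g := by
  rw [← Finset.insert_erase hv, EE_insert p (Finset.notMem_erase v Λ),
    EE_insert p (Finset.notMem_erase v Λ)]
  simp only [Finset.insert_idem]
  have : 0 ≤ EE p (Λ.erase v) g := EE_nonneg h0.le h1 fun T _ => hg T
  have h3 : 0 ≤ p⁻¹ * ((1 - p) * EE p (Λ.erase v) g) :=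
    mul_nonneg (by positivity) (mul_nonneg (by linarith) this)
  rw [mul_add, ← mul_assoc p⁻¹, inv_mul_cancel₀ h0.ne']
  linarith

/-- Block comparison for antitone functions. -/
lemma EE_block {p : ℝ} (h0 : 0 < p) (h1 : p ≤ 1) {Λ : Finset V} {f : Finset V → ℝ}
    (hf : Antitone f) (A : Finset V) (hA : A ⊆ Λ) :
    EE p Λ (fun T => f T - f (T ∪ A)) ≤
      (p⁻¹) ^ A.card * ∑ v ∈ A, EE p Λ (fun T => f (T.erase v) - f (insert v T)) := by
  induction A using Finset.induction_on with
  | empty => simp [EE_const]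
  | insert v A hv ih =>
    have hA' : A ⊆ Λ := fun x hx => hA (Finset.mem_insert_of_mem hx)
    have hvΛ : v ∈ Λ := hA (Finset.mem_insert_self v A)
    have ih := ih hA'
    have pinv : 1 ≤ p⁻¹ := (one_le_inv₀ h0).2 h1
    have e1 : EE p Λ (fun T => f T - f (T ∪ insert v A)) =
        EE p Λ (fun T => f T - f (insert v T)) +
        EE p Λ (fun T => f (insert v T) - f (insert v T ∪ A)) := by
      rw [← EE_add]
      apply EE_congr
      intro T _
      rw [Finset.union_insert, Finset.insert_union]; ring
    have e2 := EE_insert_le h0 h1 hvΛ (g := fun T => f T - f (T ∪ A))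
      (fun T => sub_nonneg.2 (hf Finset.subset_union_left))
    have e3 : EE p Λ (fun T => f T - f (insert v T)) ≤
        EE p Λ (fun T => f (T.erase v) - f (insert v T)) :=
      EE_mono h0.le h1 fun T _ => sub_le_sub_right (hf (Finset.erase_subset v T)) _
    have e4 : 0 ≤ EE p Λ (fun T => f (T.erase v) - f (insert v T)) :=
      EE_nonneg h0.le h1 fun T _ => sub_nonneg.2
        (hf ((Finset.erase_subset v T).trans (Finset.subset_insert v T)))
    rw [e1, Finset.sum_insert hv, Finset.card_insert_of_notMem hv, pow_succ, mul_add]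
    have e5 : 1 ≤ (p⁻¹) ^ A.card * p⁻¹ := by
      rw [← pow_succ]; exact one_le_pow₀ pinv
    have e6 := mul_le_mul_of_nonneg_left ih (by linarith : 0 ≤ p⁻¹)
    have e7 := mul_le_mul_of_nonneg_right e5 e4
    nlinarith [e2, e3, e6, e7]

lemma PP_nonneg {p : ℝ} (h0 : 0 ≤ p) (h1 : p ≤ 1) (Λ : Finset V) (P : Finset V → Prop) :
    0 ≤ PP p Λ P := EE_nonneg h0 h1 fun _ _ => ind_nonneg _

lemma PP_mono {p : ℝ} (h0 : 0 ≤ p) (h1 : p ≤ 1) {Λ : Finset V} {P Q : Finset V → Prop}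
    (h : ∀ T, T ⊆ Λ → P T → Q T) : PP p Λ P ≤ PP p Λ Q :=
  EE_mono h0 h1 fun T hT => ind_mono (h T hT)

lemma PP_congr (p : ℝ) {Λ : Finset V} {P Q : Finset V → Prop}
    (h : ∀ T, T ⊆ Λ → (P T ↔ Q T)) : PP p Λ P = PP p Λ Q :=
  EE_congr p fun T hT => ind_congr (h T hT)

lemma PP_le_one {p : ℝ} (h0 : 0 ≤ p) (h1 : p ≤ 1) (Λ : Finset V) (P : Finset V → Prop) :
    PP p Λ P ≤ 1 := by
  have := EE_mono h0 h1 (Λ := Λ) (f := fun T => ind (P T)) (g := fun _ => 1)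
    (fun _ _ => ind_le_one _)
  rwa [EE_const] at this

lemma PP_not (p : ℝ) (Λ : Finset V) (P : Finset V → Prop) :
    PP p Λ (fun T => ¬ P T) = 1 - PP p Λ P := by
  unfold PP
  rw [EE_congr p (g := fun T => 1 - ind (P T)) (fun T _ => ind_not _), EE_sub, EE_const]

lemma PP_or_le {p : ℝ} (h0 : 0 ≤ p) (h1 : p ≤ 1) (Λ : Finset V) (P Q : Finset V → Prop) :
    PP p Λ (fun T => P T ∨ Q T) ≤ PP p Λ P + PP p Λ Q := by
  unfold PP
  rw [← EE_add]
  apply EE_mono h0 h1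
  intro T _
  by_cases hP : P T
  · rw [ind_true hP]; linarith [ind_le_one (P T ∨ Q T), ind_nonneg (Q T)]
  · rw [ind_false hP]; linarith [ind_mono (P := P T ∨ Q T) (Q := Q T) (by tauto)]

lemma PP_exists_le {ι : Type*} {p : ℝ} (h0 : 0 ≤ p) (h1 : p ≤ 1) (Λ : Finset V) (s : Finset ι)
    (P : ι → Finset V → Prop) :
    PP p Λ (fun T => ∃ i ∈ s, P i T) ≤ ∑ i ∈ s, PP p Λ (P i) := by
  unfold PP
  rw [← EE_sum]
  apply EE_mono h0 h1
  intro T _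
  by_cases h : ∃ i ∈ s, P i T
  · rw [ind_true h]
    obtain ⟨i, hi, hP⟩ := h
    calc (1:ℝ) = ind (P i T) := (ind_true hP).symm
      _ ≤ _ := Finset.single_le_sum (f := fun i => ind (P i T)) (fun _ _ => ind_nonneg _) hi
  · rw [ind_false h]; exact Finset.sum_nonneg fun _ _ => ind_nonneg _

end Expect
end Perc

namespace Perc

/-- `x` and `y` are joined by a path in `S` for the adjacency relation `adj`. -/
def Conn (adj : ℤ × ℤ → ℤ × ℤ → Prop) (S : Set (ℤ × ℤ)) (x y : ℤ × ℤ) : Prop :=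
  x ∈ S ∧ Relation.ReflTransGen (fun a b => adj a b ∧ b ∈ S) x y

/-- King-move adjacency (with equality allowed). -/
def Kadj (v w : ℤ × ℤ) : Prop := |v.1 - w.1| ≤ 1 ∧ |v.2 - w.2| ≤ 1

section ConnLemmas
variable {adj : ℤ × ℤ → ℤ × ℤ → Prop} {S T : Set (ℤ × ℤ)} {x y z : ℤ × ℤ}

lemma Conn.refl (h : x ∈ S) : Conn adj S x x := ⟨h, Relation.ReflTransGen.refl⟩
lemma Conn.mem_left (h : Conn adj S x y) : x ∈ S := h.1
lemma Conn.mem_right (h : Conn adj S x y) : y ∈ S := by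
  obtain ⟨h1, h2⟩ := h
  cases h2 with
  | refl => exact h1
  | tail _ h => exact h.2
lemma Conn.mono (hST : S ⊆ T) (h : Conn adj S x y) : Conn adj T x y :=
  ⟨hST h.1, Relation.ReflTransGen.mono (fun _ _ h => ⟨h.1, hST h.2⟩) _ _ h.2⟩
lemma Conn.trans (h : Conn adj S x y) (h' : Conn adj S y z) : Conn adj S x z :=
  ⟨h.1, h.2.trans h'.2⟩
lemma Conn.tail (h : Conn adj S x y) (ha : adj y z) (hz : z ∈ S) : Conn adj S x z :=
  ⟨h.1, h.2.tail ⟨ha, hz⟩⟩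

lemma Conn.ind {P : ℤ × ℤ → Prop} (h : Conn adj S x y) (h0 : P x)
    (hs : ∀ u v, Conn adj S x u → P u → adj u v → v ∈ S → P v) : P y := by
  obtain ⟨h1, h2⟩ := h
  induction h2 with
  | refl => exact h0
  | tail h3 h4 ih => exact hs _ _ ⟨h1, h3⟩ ih h4.1 h4.2

lemma Conn.symm (hs : ∀ a b, adj a b → adj b a) (h : Conn adj S x y) : Conn adj S y x := by
  refine h.ind (P := fun y => Conn adj S y x) (Conn.refl h.1) ?_
  intro u v _ ih huv hv
  exact Conn.trans (Conn.tail (Conn.refl hv) (hs _ _ huv) ih.mem_left) ih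

/-- First exit from a region `R`. -/
lemma Conn.hit (R : Set (ℤ × ℤ)) (h : Conn adj S x y) (hx : x ∈ R) :
    Conn adj (S ∩ R) x y ∨
      ∃ u u', Conn adj (S ∩ R) x u ∧ u' ∉ R ∧ u' ∈ S ∧ adj u u' := by
  refine h.ind (P := fun y => Conn adj (S ∩ R) x y ∨
      ∃ u u', Conn adj (S ∩ R) x u ∧ u' ∉ R ∧ u' ∈ S ∧ adj u u') (Or.inl (Conn.refl ⟨h.1, hx⟩)) ?_
  intro u v _ ih huv hv
  rcases ih with ih | ih
  · by_cases hvR : v ∈ R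
    · exact Or.inl (ih.tail huv ⟨hv, hvR⟩)
    · exact Or.inr ⟨u, v, ih, hvR, hv, huv⟩
  · exact Or.inr ih

end ConnLemmas

lemma adjacent_king {v w : ℤ × ℤ} (h : Adjacent v w) : Kadj v w := by
  unfold Adjacent at h; unfold Kadj
  have h1 := abs_nonneg (v.1 - w.1)
  have h2 := abs_nonneg (v.2 - w.2)
  constructor <;> linarith

lemma kadj_iff {v w : ℤ × ℤ} : Kadj v w ↔
    v.1 - w.1 ≤ 1 ∧ w.1 - v.1 ≤ 1 ∧ v.2 - w.2 ≤ 1 ∧ w.2 - v.2 ≤ 1 := by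
  unfold Kadj; rw [abs_le, abs_le]; constructor
  · rintro ⟨⟨_, _⟩, _, _⟩; refine ⟨?_, ?_, ?_, ?_⟩ <;> omega
  · rintro ⟨_, _, _, _⟩; refine ⟨⟨?_, ?_⟩, ?_, ?_⟩ <;> omega

lemma adjacent_iff {v w : ℤ × ℤ} : Adjacent v w ↔
    (v.1 = w.1 ∧ (w.2 = v.2 + 1 ∨ v.2 = w.2 + 1)) ∨
    (v.2 = w.2 ∧ (w.1 = v.1 + 1 ∨ v.1 = w.1 + 1)) := by
  unfold Adjacent
  rcases abs_cases (v.1 - w.1) with ⟨h, _⟩ | ⟨h, _⟩ <;>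
  rcases abs_cases (v.2 - w.2) with ⟨h', _⟩ | ⟨h', _⟩ <;> rw [h, h'] <;> omega

/-! ### Parity -/

/-- `ZMod 2` valued indicator. -/
noncomputable def bz (P : Prop) : ZMod 2 := by classical exact if P then 1 else 0

lemma bz_true {P : Prop} (h : P) : bz P = 1 := by simp [bz, h]
lemma bz_false {P : Prop} (h : ¬ P) : bz P = 0 := by simp [bz, h]
lemma bz_eq {P Q : Prop} (h : P ↔ Q) : bz P = bz Q := by rw [propext h]

lemma tele2 (f : ℕ → ZMod 2) (n : ℕ) :
    ∑ i ∈ Finset.range n, (f i + f (i + 1)) = f 0 + f n := by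
  induction n with
  | zero => simp [CharTwo.add_self_eq_zero]
  | succ n ih =>
    rw [Finset.sum_range_succ, ih]
    linear_combination CharTwo.add_self_eq_zero (f n)

lemma rtg_seq {α : Type*} {r : α → α → Prop} {x y : α} (h : Relation.ReflTransGen r x y) :
    ∃ (l : ℕ) (g : ℕ → α), g 0 = x ∧ g l = y ∧ ∀ i < l, r (g i) (g (i + 1)) := by
  induction h with
  | refl => exact ⟨0, fun _ => x, rfl, rfl, by simp⟩
  | @tail b c _ h2 ih =>
    obtain ⟨l, g, h0, hl, hg⟩ := ih
    refine ⟨l + 1, fun i => if i ≤ l then g i else c, by simp [h0], by simp, ?_⟩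
    intro i hi
    by_cases hil : i < l
    · simp only [if_pos (by omega : i ≤ l), if_pos (by omega : i + 1 ≤ l)]
      exact hg i hil
    · have : i = l := by omega
      subst this
      simp [hl, h2]

lemma step_h {x y a1 b1 a2 b2 : ℤ} (k1 : a1 - a2 ≤ 1) (k2 : a2 - a1 ≤ 1) (k3 : b1 - b2 ≤ 1)
    (k4 : b2 - b1 ≤ 1) (h1 : ¬ (a1 = x ∧ b1 = y)) (h2 : ¬ (a2 = x ∧ b2 = y))
    (h3 : ¬ (a1 = x + 1 ∧ b1 = y)) (h4 : ¬ (a2 = x + 1 ∧ b2 = y)) :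
    (bz (b1 ≤ y) + bz (b2 ≤ y)) * bz (x < max a1 a2) =
    (bz (b1 ≤ y) + bz (b2 ≤ y)) * bz (x + 1 < max a1 a2) := by
  by_cases e : (b1 ≤ y ↔ b2 ≤ y)
  · rw [bz_eq e, CharTwo.add_self_eq_zero]; ring
  · rw [bz_eq (P := x < max a1 a2) (Q := x + 1 < max a1 a2) (by omega)]

lemma step_v {x y a1 b1 a2 b2 : ℤ} (k1 : a1 - a2 ≤ 1) (k2 : a2 - a1 ≤ 1) (k3 : b1 - b2 ≤ 1)
    (k4 : b2 - b1 ≤ 1)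
    (h1 : ¬ (a1 = x ∧ b1 = y + 1)) (h2 : ¬ (a2 = x ∧ b2 = y + 1)) :
    (bz (b1 ≤ y) + bz (b2 ≤ y)) * bz (x < max a1 a2) +
    (bz (b1 ≤ y + 1) + bz (b2 ≤ y + 1)) * bz (x < max a1 a2) =
    bz (b1 = y + 1 ∧ x < a1) + bz (b2 = y + 1 ∧ x < a2) := by
  have key : ∀ b : ℤ, bz (b ≤ y) + bz (b ≤ y + 1) = bz (b = y + 1) := by
    intro b
    by_cases c1 : b ≤ y
    · rw [bz_true c1, bz_true (by omega : b ≤ y + 1), bz_false (by omega : ¬ b = y + 1)]; rfl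
    · by_cases c2 : b = y + 1
      · rw [bz_false c1, bz_true (by omega : b ≤ y + 1), bz_true c2]; rfl
      · rw [bz_false c1, bz_false (by omega : ¬ b ≤ y + 1), bz_false c2]; rfl
  have e : (bz (b1 ≤ y) + bz (b2 ≤ y)) * bz (x < max a1 a2) +
    (bz (b1 ≤ y + 1) + bz (b2 ≤ y + 1)) * bz (x < max a1 a2) =
    (bz (b1 = y + 1) + bz (b2 = y + 1)) * bz (x < max a1 a2) := by
    rw [← key b1, ← key b2]; ring
  rw [e]
  by_cases c1 : b1 = y + 1
  · by_cases c2 : b2 = y + 1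
    · rw [bz_true c1, bz_true c2, bz_eq (P := b1 = y + 1 ∧ x < a1) (Q := x < a1) (by omega),
        bz_eq (P := b2 = y + 1 ∧ x < a2) (Q := x < a1) (by omega), CharTwo.add_self_eq_zero,
        CharTwo.add_self_eq_zero]
      ring
    · rw [bz_true c1, bz_false c2, bz_eq (P := b1 = y + 1 ∧ x < a1) (Q := x < max a1 a2) (by omega),
        bz_false (by omega : ¬ (b2 = y + 1 ∧ x < a2))]
      ring
  · by_cases c2 : b2 = y + 1
    · rw [bz_false c1, bz_true c2, bz_eq (P := b2 = y + 1 ∧ x < a2) (Q := x < max a1 a2) (by omega),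
        bz_false (by omega : ¬ (b1 = y + 1 ∧ x < a1))]
      ring
    · rw [bz_false c1, bz_false c2, bz_false (by omega : ¬ (b1 = y + 1 ∧ x < a1)),
        bz_false (by omega : ¬ (b2 = y + 1 ∧ x < a2))]
      ring

/-- A nearest-neighbour left-right crossing and a king top-bottom crossing must meet. -/
lemma no_both {a b c d : ℤ} {S T : Set (ℤ × ℤ)} (hST : Disjoint S T)
    (hS : ∀ v ∈ S, a ≤ v.1 ∧ v.1 ≤ b ∧ c ≤ v.2 ∧ v.2 ≤ d)
    (hT : ∀ v ∈ T, a ≤ v.1 ∧ v.1 ≤ b ∧ c ≤ v.2 ∧ v.2 ≤ d)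
    {u u' w w' : ℤ × ℤ} (hu : u.1 = a) (hu' : u'.1 = b) (hγ : Conn Adjacent S u u')
    (hw : w.2 = c) (hw' : w'.2 = d) (hδ : Conn Kadj T w w') : False := by
  obtain ⟨l, g, g0, gl, hg⟩ := rtg_seq
    (r := fun v v' => Kadj v v' ∧ v' ∈ insert (w'.1, d + 1) T)
    (Relation.ReflTransGen.tail
      (Relation.ReflTransGen.mono (fun _ _ h => ⟨h.1, Set.mem_insert_of_mem _ h.2⟩) _ _ hδ.2)
      (⟨by rw [kadj_iff]; simp [hw'], Set.mem_insert _ _⟩ :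
        Kadj w' (w'.1, d + 1) ∧ (w'.1, d + 1) ∈ insert (w'.1, d + 1) T))
  have hgm : ∀ i ≤ l, g i ∈ insert (w'.1, d + 1) T := by
    intro i hi
    cases i with
    | zero => rw [g0]; exact Set.mem_insert_of_mem _ hδ.1
    | succ i => exact (hg i (by omega)).2
  have hcol : ∀ i ≤ l, a ≤ (g i).1 ∧ (g i).1 ≤ b := by
    intro i hi
    rcases hgm i hi with h | h
    · rw [h]; have := hT _ hδ.mem_right; exact ⟨this.1, this.2.1⟩
    · have := hT _ h; exact ⟨this.1, this.2.1⟩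
  have hav : ∀ v : ℤ × ℤ, v ∈ S → ∀ i ≤ l, ¬ ((g i).1 = v.1 ∧ (g i).2 = v.2) := by
    intro v hv i hi h
    have hgv : g i = v := Prod.ext h.1 h.2
    rcases hgm i hi with h' | h'
    · have := hS v hv
      rw [h'] at hgv
      rw [← hgv] at this
      simp at this
    · rw [hgv] at h'
      exact Set.disjoint_left.1 hST hv h'
  have hk : ∀ i < l, (g i).1 - (g (i+1)).1 ≤ 1 ∧ (g (i+1)).1 - (g i).1 ≤ 1 ∧
      (g i).2 - (g (i+1)).2 ≤ 1 ∧ (g (i+1)).2 - (g i).2 ≤ 1 := fun i hi => kadj_iff.1 (hg i hi).1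
  let N : ℤ → ℤ → ZMod 2 := fun x y => ∑ i ∈ Finset.range l,
    (bz ((g i).2 ≤ y) + bz ((g (i+1)).2 ≤ y)) * bz (x < max (g i).1 (g (i+1)).1)
  have Nh : ∀ x y : ℤ, (∀ i ≤ l, ¬ ((g i).1 = x ∧ (g i).2 = y)) →
      (∀ i ≤ l, ¬ ((g i).1 = x + 1 ∧ (g i).2 = y)) → N x y = N (x+1) y := by
    intro x y h1 h2
    apply Finset.sum_congr rfl
    intro i hi
    rw [Finset.mem_range] at hi
    obtain ⟨k1, k2, k3, k4⟩ := hk i hi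
    exact step_h k1 k2 k3 k4 (h1 i hi.le) (h1 (i+1) hi) (h2 i hi.le) (h2 (i+1) hi)
  have Nv : ∀ x y : ℤ, (∀ i ≤ l, ¬ ((g i).1 = x ∧ (g i).2 = y + 1)) → c ≤ y → y + 1 ≤ d →
      N x y = N x (y + 1) := by
    intro x y h2 hcy hyd
    have : N x y + N x (y+1) = 0 := by
      change ∑ i ∈ _, _ + ∑ i ∈ _, _ = _
      rw [← Finset.sum_add_distrib]
      rw [Finset.sum_congr rfl (g := fun i => bz ((g i).2 = y + 1 ∧ x < (g i).1) +
        bz ((g (i+1)).2 = y + 1 ∧ x < (g (i+1)).1))]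
      · rw [tele2 (fun i => bz ((g i).2 = y + 1 ∧ x < (g i).1)), g0, gl, bz_false, bz_false]
        · rfl
        · simp; omega
        · rw [hw]; omega
      · intro i hi
        rw [Finset.mem_range] at hi
        obtain ⟨k1, k2, k3, k4⟩ := hk i hi
        exact step_v k1 k2 k3 k4 (h2 i hi.le) (h2 (i+1) hi)
    exact CharTwo.add_eq_zero.1 this
  have N1 : N u.1 u.2 = 1 := by
    have hus := hS u hγ.1
    have e := Nh (a - 1) u.2 (fun i hi h => by have := hcol i hi; omega) (by
      have := hav u hγ.1
      rw [hu] at this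
      simpa using this)
    rw [hu]
    rw [show a - 1 + 1 = a by ring] at e
    rw [← e]
    change ∑ i ∈ _, _ = _
    rw [Finset.sum_congr rfl (g := fun i => bz ((g i).2 ≤ u.2) + bz ((g (i+1)).2 ≤ u.2))]
    · rw [tele2 (fun i => bz ((g i).2 ≤ u.2)), g0, gl, bz_true (by omega), bz_false]
      · rfl
      · simp; omega
    · intro i hi
      rw [Finset.mem_range] at hi
      have := hcol i hi.le
      rw [bz_true (P := a - 1 < _) (by omega), mul_one]
  have N2 : N u'.1 u'.2 = 1 := by
    refine hγ.ind (P := fun v => N v.1 v.2 = 1) N1 ?_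
    intro v v' hc ih hadj hv'
    have hv := hc.mem_right
    have av := hav v hv
    have av' := hav v' hv'
    have bv := hS v hv
    have bv' := hS v' hv'
    rcases adjacent_iff.1 hadj with ⟨h1, h2 | h2⟩ | ⟨h1, h2 | h2⟩
    · rw [h2, ← h1] at av' ⊢
      rw [← ih]; exact (Nv _ _ av' bv.2.2.1 (by omega)).symm
    · rw [h2, h1] at av ih
      rw [← ih]; exact (Nv _ _ av bv'.2.2.1 (by omega))
    · rw [h2, ← h1] at av' ⊢
      rw [← ih]; exact (Nh _ _ av av').symm
    · rw [h2, h1] at av ih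
      rw [← ih]; exact (Nh _ _ av' av)
  have N3 : N u'.1 u'.2 = 0 := by
    apply Finset.sum_eq_zero
    intro i hi
    rw [Finset.mem_range] at hi
    have h1 := hcol i hi.le
    have h2 := hcol (i+1) hi
    rw [hu', bz_false (P := b < _) (by omega), mul_zero]
  rw [N2] at N3
  exact one_ne_zero N3

lemma bz_bool (b : Bool) : bz (b = true) = if b then 1 else 0 := by
  cases b <;> simp [bz]

set_option synthInstance.maxSize 2000 in
set_option synthInstance.maxHeartbeats 200000 in
set_option maxRecDepth 100000 in
set_option maxHeartbeats 1000000 in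
lemma square_bool : ∀ cP cQ cR cU kP kQ kR kU : Bool,
    (kP = true → ¬ cP = true) → (kQ = true → ¬ cQ = true) →
    (kR = true → ¬ cR = true) → (kU = true → ¬ cU = true) →
    (cP = true → (cQ = true ∨ kQ = true) ∧ (cU = true ∨ kU = true)) →
    (cQ = true → (cP = true ∨ kP = true) ∧ (cR = true ∨ kR = true)) →
    (cR = true → (cQ = true ∨ kQ = true) ∧ (cU = true ∨ kU = true)) →
    (cU = true → (cP = true ∨ kP = true) ∧ (cR = true ∨ kR = true)) →
    ((if cP then (1 : ZMod 2) else 0) * (if kQ then 1 else 0) +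
      (if kP then 1 else 0) * (if cQ then 1 else 0)) +
    ((if cU then 1 else 0) * (if kR then 1 else 0) +
      (if kU then 1 else 0) * (if cR then 1 else 0)) =
    ((if cP then 1 else 0) * (if kU then 1 else 0) +
      (if kP then 1 else 0) * (if cU then 1 else 0)) +
    ((if cQ then 1 else 0) * (if kR then 1 else 0) +
      (if kQ then 1 else 0) * (if cR then 1 else 0)) := by
  decide

lemma exists_bool (P : Prop) : ∃ b : Bool, P = (b = true) := by
  by_cases h : P
  · exact ⟨true, by simp [h]⟩
  · exact ⟨false, by simp [h]⟩

lemma square_prop (cP cQ cR cU kP kQ kR kU : Prop)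
    (h1 : kP → ¬ cP) (h2 : kQ → ¬ cQ) (h3 : kR → ¬ cR) (h4 : kU → ¬ cU)
    (h5 : cP → (cQ ∨ kQ) ∧ (cU ∨ kU))
    (h6 : cQ → (cP ∨ kP) ∧ (cR ∨ kR))
    (h7 : cR → (cQ ∨ kQ) ∧ (cU ∨ kU))
    (h8 : cU → (cP ∨ kP) ∧ (cR ∨ kR)) :
    (bz cP * bz kQ + bz kP * bz cQ) + (bz cU * bz kR + bz kU * bz cR) =
      (bz cP * bz kU + bz kP * bz cU) + (bz cQ * bz kR + bz kQ * bz cR) := by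
  obtain ⟨cP, rfl⟩ := exists_bool cP
  obtain ⟨cQ, rfl⟩ := exists_bool cQ
  obtain ⟨cR, rfl⟩ := exists_bool cR
  obtain ⟨cU, rfl⟩ := exists_bool cU
  obtain ⟨kP, rfl⟩ := exists_bool kP
  obtain ⟨kQ, rfl⟩ := exists_bool kQ
  obtain ⟨kR, rfl⟩ := exists_bool kR
  obtain ⟨kU, rfl⟩ := exists_bool kU
  simp only [bz_bool]
  exact square_bool cP cQ cR cU kP kQ kR kU h1 h2 h3 h4 h5 h6 h7 h8

/-- Either there is a left-right crossing of `S` or a king top-bottom crossing of the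
complement. -/
lemma dual_exists (a c d : ℤ) (n : ℕ) (hcd : c ≤ d) (S Bx : Set (ℤ × ℤ))
    (hB : ∀ v : ℤ × ℤ, v ∈ Bx ↔ a ≤ v.1 ∧ v.1 ≤ a + n ∧ c ≤ v.2 ∧ v.2 ≤ d)
    (hno : ¬ ∃ u u' : ℤ × ℤ, u.1 = a ∧ u'.1 = a + n ∧ Conn Adjacent (S ∩ Bx) u u') :
    ∃ w w' : ℤ × ℤ, w.2 = c ∧ w'.2 = d ∧ Conn Kadj (Sᶜ ∩ Bx) w w' := by
  by_contra hK
  let C : ℤ × ℤ → Prop := fun v => v.1 < a ∨ ∃ u : ℤ × ℤ, u.1 = a ∧ Conn Adjacent (S ∩ Bx) u v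
  let K : ℤ × ℤ → Prop := fun v => ∃ w : ℤ × ℤ, w.2 = c ∧ Conn Kadj (Sᶜ ∩ Bx) w v
  have KC : ∀ v, K v → ¬ C v := by
    rintro v ⟨w, hw, h⟩ (h' | ⟨u, hu, h'⟩)
    · have := (hB v).1 h.mem_right.2; omega
    · exact h.mem_right.1 h'.mem_right.1
  have Ccol : ∀ v : ℤ × ℤ, C v → v.1 < a + n := by
    rintro v (h | ⟨u, hu, h⟩)
    · omega
    · by_contra hv
      have := (hB v).1 h.mem_right.2
      exact hno ⟨u, v, hu, by omega, h⟩
  have Cnb : ∀ v w : ℤ × ℤ, Adjacent v w → C v → c ≤ w.2 → w.2 ≤ d →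
      C w ∨ w ∈ Sᶜ ∩ Bx := by
    intro v w hvw hv h1 h2
    by_cases hwB : w ∈ Bx
    · by_cases hwS : w ∈ S
      · left
        rcases hv with hv | ⟨u, hu, hv⟩
        · right
          have := (hB w).1 hwB
          refine ⟨w, ?_, Conn.refl ⟨hwS, hwB⟩⟩
          rcases adjacent_iff.1 hvw with ⟨_, _⟩ | ⟨_, _⟩ <;> omega
        · exact Or.inr ⟨u, hu, hv.tail hvw ⟨hwS, hwB⟩⟩
      · exact Or.inr ⟨hwS, hwB⟩
    · left; left
      have := Ccol v hv
      by_contra h3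
      apply hwB
      rw [hB]
      rcases adjacent_iff.1 hvw with ⟨_, _⟩ | ⟨_, _⟩ <;> omega
  have Knb : ∀ v w : ℤ × ℤ, Kadj v w → K v → w ∈ Sᶜ ∩ Bx → K w := by
    rintro v w hvw ⟨u, hu, h⟩ hw
    exact ⟨u, hu, h.tail hvw hw⟩
  let e : ℤ × ℤ → ℤ × ℤ → ZMod 2 := fun s t => bz (C s) * bz (K t) + bz (K s) * bz (C t)
  have square : ∀ x y : ℤ, c ≤ y → y + 1 ≤ d →
      e (x, y) (x+1, y) + e (x, y+1) (x+1, y+1) = e (x, y) (x, y+1) + e (x+1, y) (x+1, y+1) := by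
    intro x y hy hy'
    by_cases hk : K (x, y) ∨ K (x+1, y) ∨ K (x+1, y+1) ∨ K (x, y+1)
    · have hz : ∀ w : ℤ × ℤ, (w.1 = x ∨ w.1 = x + 1) → (w.2 = y ∨ w.2 = y + 1) →
          w ∈ Sᶜ ∩ Bx → K w := by
        intro w h1 h2 hw
        rcases hk with h | h | h | h <;>
        · refine Knb _ w ?_ h hw
          rw [kadj_iff]
          dsimp only
          omega
      have hc : ∀ v w : ℤ × ℤ, Adjacent v w → (w.1 = x ∨ w.1 = x + 1) →
          (w.2 = y ∨ w.2 = y + 1) → C v → C w ∨ K w := by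
        intro v w hvw h1 h2 hv
        rcases Cnb v w hvw hv (by omega) (by omega) with h | h
        · exact Or.inl h
        · exact Or.inr (hz w h1 h2 h)
      apply square_prop
      · exact KC _
      · exact KC _
      · exact KC _
      · exact KC _
      · exact fun h => ⟨hc _ _ (adjacent_iff.2 (by simp)) (by simp) (by simp) h,
          hc _ _ (adjacent_iff.2 (by simp)) (by simp) (by simp) h⟩
      · exact fun h => ⟨hc _ _ (adjacent_iff.2 (by simp)) (by simp) (by simp) h,
          hc _ _ (adjacent_iff.2 (by simp)) (by simp) (by simp) h⟩
      · exact fun h => ⟨hc _ _ (adjacent_iff.2 (by simp)) (by simp) (by simp) h,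
          hc _ _ (adjacent_iff.2 (by simp)) (by simp) (by simp) h⟩
      · exact fun h => ⟨hc _ _ (adjacent_iff.2 (by simp)) (by simp) (by simp) h,
          hc _ _ (adjacent_iff.2 (by simp)) (by simp) (by simp) h⟩
    · push Not at hk
      simp only [e, bz_false hk.1, bz_false hk.2.1, bz_false hk.2.2.1, bz_false hk.2.2.2]
      ring
  let h : ℤ → ZMod 2 := fun y => ∑ i ∈ Finset.range (n + 2),
    e (a - 1 + (i : ℤ), y) (a - 1 + (i : ℤ) + 1, y)
  have hstep : ∀ y, c ≤ y → y + 1 ≤ d → h y = h (y + 1) := by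
    intro y hy hy'
    have : h y + h (y+1) = 0 := by
      change ∑ i ∈ _, _ + ∑ i ∈ _, _ = _
      rw [← Finset.sum_add_distrib]
      rw [Finset.sum_congr rfl (fun (i : ℕ) _ => square (a - 1 + (i : ℤ)) y hy hy')]
      have t := tele2 (fun i : ℕ => e (a - 1 + (i : ℤ), y) (a - 1 + (i : ℤ), y + 1)) (n + 2)
      simp only [Nat.cast_add, Nat.cast_one, Nat.cast_ofNat, ← add_assoc] at t
      rw [t]
      have k1 : ∀ y, ¬ K (a - 1 + ((0 : ℕ) : ℤ), y) := by
        rintro y ⟨w, _, hw⟩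
        have := (hB _).1 hw.mem_right.2
        simp at this
      have k2 : ∀ y, ¬ K (a - 1 + (n : ℤ) + 2, y) := by
        rintro y ⟨w, _, hw⟩
        have := (hB _).1 hw.mem_right.2
        simp at this
        omega
      simp only [e, bz_false (k1 _), bz_false (k2 _)]
      ring
    exact CharTwo.add_eq_zero.1 this
  have hall : ∀ y, c ≤ y → y ≤ d → h y = h c := by
    intro y hy
    induction y, hy using Int.leInduction with
    | base => intro _; rfl
    | succ y hy ih => intro hy'; rw [← hstep y hy hy', ih (by omega)]
  have hc1 : h c = 1 := by
    change ∑ i ∈ _, _ = _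
    rw [Finset.sum_congr rfl (g := fun i : ℕ => bz (C (a - 1 + (i : ℤ), c)) +
      bz (C (a - 1 + ((i + 1 : ℕ) : ℤ), c)))]
    · rw [tele2 (fun i : ℕ => bz (C (a - 1 + (i : ℤ), c))), bz_true, bz_false]
      · rfl
      · intro hh
        have := Ccol _ hh
        push_cast at this
        omega
      · left; simp
    · intro i _
      have hcase : ∀ s t : ℤ × ℤ, Adjacent s t → t.2 = c → C s → ¬ C t → K t := by
        intro s t hst ht hs hnt
        rcases Cnb s t hst hs (by omega) (by omega) with hh | hh
        · exact absurd hh hnt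
        · exact ⟨t, ht, Conn.refl hh⟩
      simp only [e, Nat.cast_add, Nat.cast_one, ← add_assoc]
      set s : ℤ × ℤ := (a - 1 + (i:ℤ), c) with hs
      set t : ℤ × ℤ := (a - 1 + (i:ℤ) + 1, c) with ht
      have hst : Adjacent s t := adjacent_iff.2 (by simp [hs, ht])
      have hts : Adjacent t s := adjacent_iff.2 (by simp [hs, ht])
      by_cases c1 : C s <;> by_cases c2 : C t
      · rw [bz_true c1, bz_true c2, bz_false (fun hh => KC _ hh c1),
          bz_false (fun hh => KC _ hh c2)]; rfl
      · rw [bz_true c1, bz_false c2, bz_false (fun hh => KC _ hh c1),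
          bz_true (hcase s t hst rfl c1 c2)]; rfl
      · rw [bz_true c2, bz_false c1, bz_false (fun hh => KC _ hh c2),
          bz_true (hcase t s hts rfl c2 c1)]; rfl
      · rw [bz_false c1, bz_false c2]; ring
  have hd0 : h d = 0 := by
    apply Finset.sum_eq_zero
    intro i _
    have k : ∀ x, ¬ K (x, d) := fun x ⟨w, hw, hh⟩ => hK ⟨w, (x, d), hw, rfl, hh⟩
    simp only [e, bz_false (k _)]
    ring
  rw [hall d hcd le_rfl, hc1] at hd0
  exact one_ne_zero hd0

end Perc

namespace Perc

/-- The box `{-N,…,N}²`. -/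
noncomputable def Bx (N : ℕ) : Finset (ℤ × ℤ) := Finset.Icc (-(N:ℤ), -(N:ℤ)) ((N:ℤ), (N:ℤ))

lemma mem_Bx {N : ℕ} {v : ℤ × ℤ} :
    v ∈ Bx N ↔ -(N:ℤ) ≤ v.1 ∧ v.1 ≤ N ∧ -(N:ℤ) ≤ v.2 ∧ v.2 ≤ N := by
  unfold Bx
  rw [Finset.mem_Icc, Prod.le_def, Prod.le_def]
  tauto

/-- One side of the box. -/
noncomputable def Side (f : ℤ × ℤ → ℤ) (N : ℕ) : Finset (ℤ × ℤ) := (Bx N).filter (fun v => f v = N)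

/-- The boundary layer of the box. -/
noncomputable def Lay (N : ℕ) : Finset (ℤ × ℤ) :=
  (Bx N).filter (fun v => v.1 = N ∨ v.1 = -N ∨ v.2 = N ∨ v.2 = -N)

lemma mem_Side {f : ℤ × ℤ → ℤ} {N : ℕ} {v : ℤ × ℤ} : v ∈ Side f N ↔ v ∈ Bx N ∧ f v = N := by
  simp [Side]

lemma mem_Lay {N : ℕ} {v : ℤ × ℤ} :
    v ∈ Lay N ↔ v ∈ Bx N ∧ (v.1 = N ∨ v.1 = -N ∨ v.2 = N ∨ v.2 = -N) := by
  simp [Lay]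

lemma Bx_mono {m n : ℕ} (h : m ≤ n) : Bx m ⊆ Bx n := by
  intro v hv
  rw [mem_Bx] at hv ⊢
  omega

lemma zero_mem_Bx (n : ℕ) : (0 : ℤ × ℤ) ∈ Bx n := by
  rw [mem_Bx]; simp

/-- Adjacency relations with the symmetries we need. -/
structure GoodAdj (adj : ℤ × ℤ → ℤ × ℤ → Prop) : Prop where
  symm : ∀ a b, adj a b → adj b a
  king : ∀ a b, adj a b → Kadj a b
  nn : ∀ a b, Adjacent a b → adj a b
  shift : ∀ x a b, adj (a + x) (b + x) ↔ adj a b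
  flip : ∀ a b : ℤ × ℤ, adj (-a.1, a.2) (-b.1, b.2) ↔ adj a b
  swap : ∀ a b : ℤ × ℤ, adj (a.2, a.1) (b.2, b.1) ↔ adj a b

lemma goodAdj_adjacent : GoodAdj Adjacent where
  symm a b h := by rw [adjacent_iff] at h ⊢; omega
  king a b h := adjacent_king h
  nn a b h := h
  shift x a b := by rw [adjacent_iff, adjacent_iff]; simp only [Prod.fst_add, Prod.snd_add]; omega
  flip a b := by rw [adjacent_iff, adjacent_iff]; dsimp only; omega
  swap a b := by rw [adjacent_iff, adjacent_iff]; dsimp only; omega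

lemma goodAdj_kadj : GoodAdj Kadj where
  symm a b h := by rw [kadj_iff] at h ⊢; omega
  king a b h := h
  nn a b h := adjacent_king h
  shift x a b := by rw [kadj_iff, kadj_iff]; simp only [Prod.fst_add, Prod.snd_add]; omega
  flip a b := by rw [kadj_iff, kadj_iff]; dsimp only; omega
  swap a b := by rw [kadj_iff, kadj_iff]; dsimp only; omega

/-- Some vertex of `A` is joined to some vertex of `L` within `T`. -/
def Arm (adj : ℤ × ℤ → ℤ × ℤ → Prop) (T : Set (ℤ × ℤ)) (A L : Finset (ℤ × ℤ)) : Prop :=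
  ∃ a ∈ A, ∃ v ∈ L, Conn adj T a v

/-- Probability that the origin is joined to the boundary of the box. -/
noncomputable def th (adj : ℤ × ℤ → ℤ × ℤ → Prop) (p : ℝ) (N : ℕ) : ℝ :=
  PP p (Bx N) (fun T => ∃ v ∈ Lay N, Conn adj T 0 v)

variable {adj : ℤ × ℤ → ℤ × ℤ → Prop}

lemma Conn.image {S : Set (ℤ × ℤ)} {x y : ℤ × ℤ} (σ : ℤ × ℤ → ℤ × ℤ)
    (hσ : ∀ a b, adj a b → adj (σ a) (σ b)) (h : Conn adj S x y) :
    Conn adj (σ '' S) (σ x) (σ y) := by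
  refine h.ind (P := fun y => Conn adj (σ '' S) (σ x) (σ y)) (Conn.refl ⟨x, h.1, rfl⟩) ?_
  intro u v _ ih huv hv
  exact ih.tail (hσ _ _ huv) ⟨v, hv, rfl⟩

lemma conn_map (σ : ℤ × ℤ ≃ ℤ × ℤ) (hσ : ∀ a b, adj (σ a) (σ b) ↔ adj a b)
    (T : Finset (ℤ × ℤ)) (x y : ℤ × ℤ) :
    Conn adj ↑(T.map σ.toEmbedding) (σ x) (σ y) ↔ Conn adj ↑T x y := by
  rw [Finset.coe_map]
  constructor
  · intro h
    have := h.image σ.symm (fun a b hab => by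
      rw [← hσ]; simpa using hab)
    simpa [Set.image_image] using this
  · intro h
    exact h.image σ fun a b hab => (hσ a b).2 hab

lemma arm_map (σ : ℤ × ℤ ≃ ℤ × ℤ) (hσ : ∀ a b, adj (σ a) (σ b) ↔ adj a b)
    (T A L : Finset (ℤ × ℤ)) :
    Arm adj ↑(T.map σ.toEmbedding) (A.map σ.toEmbedding) (L.map σ.toEmbedding) ↔
      Arm adj ↑T A L := by
  unfold Arm
  constructor
  · rintro ⟨a, ha, v, hv, h⟩
    rw [Finset.mem_map] at ha hv
    obtain ⟨a, ha, rfl⟩ := ha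
    obtain ⟨v, hv, rfl⟩ := hv
    exact ⟨a, ha, v, hv, (conn_map σ hσ T a v).1 h⟩
  · rintro ⟨a, ha, v, hv, h⟩
    exact ⟨σ a, Finset.mem_map.2 ⟨a, ha, rfl⟩, σ v, Finset.mem_map.2 ⟨v, hv, rfl⟩,
      (conn_map σ hσ T a v).2 h⟩

lemma Arm.mono {S T : Set (ℤ × ℤ)} (h : S ⊆ T) {A A' L L' : Finset (ℤ × ℤ)} (hA : A ⊆ A')
    (hL : L ⊆ L') : Arm adj S A L → Arm adj T A' L' := by
  rintro ⟨a, ha, v, hv, hc⟩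
  exact ⟨a, hA ha, v, hL hv, hc.mono h⟩

lemma reach_layer (G : GoodAdj adj) {S : Set (ℤ × ℤ)} {x y : ℤ × ℤ} {N : ℕ}
    (h : Conn adj S x y) (hx : x ∈ Bx N) (hy : y ∈ Bx N → y ∈ Lay N) :
    ∃ v ∈ Lay N, Conn adj (S ∩ ↑(Bx N)) x v := by
  rcases h.hit (↑(Bx N)) hx with h | ⟨u, u', h, hu', _, ha⟩
  · exact ⟨y, hy h.mem_right.2, h⟩
  · refine ⟨u, ?_, h⟩
    have hu : u ∈ Bx N := h.mem_right.2
    have hk := kadj_iff.1 (G.king _ _ ha)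
    have hu'' : u' ∉ Bx N := hu'
    rw [mem_Lay]
    refine ⟨hu, ?_⟩
    rw [mem_Bx] at hu hu''
    omega

lemma shift_marg (p : ℝ) (σ : ℤ × ℤ ≃ ℤ × ℤ) {A Λ : Finset (ℤ × ℤ)}
    (h : A ⊆ Λ.map σ.toEmbedding) (f : Finset (ℤ × ℤ) → ℝ) :
    EE p Λ (fun T => f (T.map σ.toEmbedding ∩ A)) = EE p A f := by
  rw [← EE_marg p h f, EE_map]

lemma arm_outside (G : GoodAdj adj) {S : Set (ℤ × ℤ)} {m N : ℕ} (hN : m + 1 ≤ N)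
    (h : Arm adj S (Bx (m+1)) (Lay N)) : Arm adj (S \ ↑(Bx m)) (Bx (m+1)) (Lay N) := by
  obtain ⟨a, ha, v, hv, hc⟩ := h
  have hvm : v ∉ Bx m := by
    intro hvm
    rw [mem_Lay] at hv
    rw [mem_Bx] at hvm
    omega
  rcases (hc.symm G.symm).hit ((↑(Bx m) : Set (ℤ × ℤ))ᶜ) hvm with h | ⟨u, u', h, hu', _, hadj⟩
  · exact ⟨a, ha, v, hv, h.symm G.symm⟩
  · refine ⟨u, ?_, v, hv, h.symm G.symm⟩
    have hu'' : u' ∈ Bx m := by simpa using hu'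
    have hk := kadj_iff.1 (G.king _ _ hadj)
    rw [mem_Bx] at hu'' ⊢
    push_cast
    omega

lemma th_nonneg {p : ℝ} (h0 : 0 ≤ p) (h1 : p ≤ 1) (N : ℕ) : 0 ≤ th adj p N :=
  PP_nonneg h0 h1 _ _

lemma arms_step (G : GoodAdj adj) {p : ℝ} (h0 : 0 ≤ p) (h1 : p ≤ 1) {m N : ℕ} (hN : m + 1 ≤ N) :
    th adj p m * PP p (Bx N) (fun T => ¬ Arm adj ↑T (Bx (m+1)) (Lay N)) ≤
      th adj p m - th adj p N := by
  have hsub : Bx m ⊆ Bx N := Bx_mono (by omega)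
  have e1 : PP p (Bx N) (fun T => ¬ Arm adj ↑T (Bx (m+1)) (Lay N)) =
      EE p (Bx N \ Bx m) (fun T => ind (¬ Arm adj ↑T (Bx (m+1)) (Lay N))) := by
    rw [← EE_marg']
    apply PP_congr
    intro T _
    rw [not_iff_not, Finset.coe_sdiff]
    exact ⟨arm_outside G hN, Arm.mono Set.sdiff_subset subset_rfl subset_rfl⟩
  have e2 : th adj p m = EE p (Bx m) (fun T => ind (∃ v ∈ Lay m, Conn adj T 0 v)) := rfl
  have e3 := EE_indep p hsub (fun T => ind (∃ v ∈ Lay m, Conn adj T 0 v))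
    (fun T => ind (¬ Arm adj ↑T (Bx (m+1)) (Lay N)))
  rw [e1]
  conv_lhs => rw [e2, ← e3]
  have e4 : th adj p m - th adj p N = EE p (Bx N) (fun T =>
      ind (∃ v ∈ Lay m, Conn adj ↑(T ∩ Bx m) 0 v) - ind (∃ v ∈ Lay N, Conn adj T 0 v)) := by
    rw [EE_sub, EE_marg p hsub (fun T => ind (∃ v ∈ Lay m, Conn adj ↑T 0 v))]
    rfl
  rw [e4]
  apply EE_mono h0 h1
  intro T hT
  by_cases hH : ∃ v ∈ Lay N, Conn adj (↑T : Set (ℤ × ℤ)) 0 v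
  · have hF : ∃ v ∈ Lay m, Conn adj (↑(T ∩ Bx m) : Set (ℤ × ℤ)) 0 v := by
      obtain ⟨v, hv, hc⟩ := hH
      rw [Finset.coe_inter]
      refine reach_layer G hc (zero_mem_Bx m) ?_
      intro hv'
      rw [mem_Lay] at hv
      rw [mem_Bx] at hv'
      omega
    have hE : Arm adj (↑(T \ Bx m) : Set (ℤ × ℤ)) (Bx (m+1)) (Lay N) := by
      rw [Finset.coe_sdiff]
      obtain ⟨v, hv, hc⟩ := hH
      exact arm_outside G hN ⟨0, zero_mem_Bx _, v, hv, hc⟩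
    rw [ind_true hH, ind_true hF, ind_false (not_not.2 hE)]
    norm_num
  · rw [ind_false hH]
    have a := ind_nonneg (∃ v ∈ Lay m, Conn adj (↑(T ∩ Bx m) : Set (ℤ × ℤ)) 0 v)
    have b := ind_le_one (¬ Arm adj (↑(T \ Bx m) : Set (ℤ × ℤ)) (Bx (m+1)) (Lay N))
    nlinarith

/-- If the origin percolates then big boxes are very likely to be joined to far away. -/
lemma arms_high (G : GoodAdj adj) {p c ε : ℝ} (h0 : 0 ≤ p) (h1 : p ≤ 1) (hc : 0 < c)
    (hth : ∀ N, c ≤ th adj p N) (hε : 0 < ε) :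
    ∃ m : ℕ, ∀ N, m ≤ N → PP p (Bx N) (fun T => ¬ Arm adj ↑T (Bx m) (Lay N)) ≤ ε := by
  have hbdd : BddBelow (Set.range (th adj p)) := ⟨c, by rintro _ ⟨N, rfl⟩; exact hth N⟩
  obtain ⟨m, hm⟩ : ∃ m, th adj p m < (⨅ N, th adj p N) + c * ε :=
    exists_lt_of_ciInf_lt (lt_add_of_pos_right _ (mul_pos hc hε))
  refine ⟨m + 1, fun N hN => ?_⟩
  have h2 := arms_step G h0 h1 hN
  have h3 : (⨅ N, th adj p N) ≤ th adj p N := ciInf_le hbdd N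
  have h4 := PP_nonneg h0 h1 (Bx N) (fun T => ¬ Arm adj ↑T (Bx (m+1)) (Lay N))
  have h5 := mul_le_mul_of_nonneg_right (hth m) h4
  have h6 : c * PP p (Bx N) (fun T => ¬ Arm adj ↑T (Bx (m+1)) (Lay N)) ≤ c * ε := by linarith
  exact le_of_mul_le_mul_left h6 hc

/-- Reflection in the second axis. -/
def flipE : ℤ × ℤ ≃ ℤ × ℤ where
  toFun v := (-v.1, v.2)
  invFun v := (-v.1, v.2)
  left_inv v := by simp
  right_inv v := by simp

lemma Bx_map_flip (N : ℕ) : (Bx N).map flipE.toEmbedding = Bx N := by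
  ext v
  rw [Finset.mem_map_equiv, mem_Bx, mem_Bx]
  simp only [flipE, Equiv.coe_fn_symm_mk]
  omega

lemma Bx_map_swap (N : ℕ) : (Bx N).map (Equiv.prodComm ℤ ℤ).toEmbedding = Bx N := by
  ext v
  rw [Finset.mem_map_equiv, mem_Bx, mem_Bx]
  simp
  omega

lemma side_equal (p : ℝ) (σ : ℤ × ℤ ≃ ℤ × ℤ) (hσ : ∀ a b, adj (σ a) (σ b) ↔ adj a b)
    (hB : ∀ N, (Bx N).map σ.toEmbedding = Bx N) (f g : ℤ × ℤ → ℤ) (hfg : ∀ v, g (σ v) = f v)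
    (m N : ℕ) :
    PP p (Bx N) (fun T => ¬ Arm adj ↑T (Bx m) (Side g N)) =
      PP p (Bx N) (fun T => ¬ Arm adj ↑T (Bx m) (Side f N)) := by
  unfold PP
  conv_lhs => rw [← hB N]
  rw [EE_map]
  apply EE_congr
  intro T _
  apply ind_congr
  rw [not_iff_not, ← arm_map σ hσ T, hB]
  have : (Side f N).map σ.toEmbedding = Side g N := by
    ext v
    rw [Finset.mem_map_equiv, mem_Side, mem_Side, ← hfg]
    have h2 : σ.symm v ∈ Bx N ↔ v ∈ Bx N := by
      conv_rhs => rw [← hB N, Finset.mem_map_equiv]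
    rw [h2]
    simp
  rw [this]

lemma side_high (G : GoodAdj adj) {p e : ℝ} (h0 : 0 ≤ p) (h1 : p ≤ 1) (he : 0 ≤ e) {m N : ℕ}
    (h : PP p (Bx N) (fun T => ¬ Arm adj ↑T (Bx m) (Lay N)) ≤ e ^ 4) :
    PP p (Bx N) (fun T => ¬ Arm adj ↑T (Bx m) (Side (fun v => v.1) N)) ≤ e ∧
    PP p (Bx N) (fun T => ¬ Arm adj ↑T (Bx m) (Side (fun v => -v.1) N)) ≤ e ∧
    PP p (Bx N) (fun T => ¬ Arm adj ↑T (Bx m) (Side (fun v => v.2) N)) ≤ e ∧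
    PP p (Bx N) (fun T => ¬ Arm adj ↑T (Bx m) (Side (fun v => -v.2) N)) ≤ e := by
  have s1 := side_equal (adj := adj) p flipE (fun a b => G.flip a b) Bx_map_flip
    (fun v => v.1) (fun v => -v.1) (fun v => by simp [flipE]) m N
  have s2 := side_equal (adj := adj) p (Equiv.prodComm ℤ ℤ) (fun a b => G.swap a b) Bx_map_swap
    (fun v => v.1) (fun v => v.2) (fun v => by simp) m N
  have s3 := side_equal (adj := adj) p (Equiv.prodComm ℤ ℤ) (fun a b => G.swap a b) Bx_map_swap
    (fun v => -v.1) (fun v => -v.2) (fun v => by simp) m N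
  rw [s3, s1, s2]
  have anti : ∀ f : ℤ × ℤ → ℤ,
      Antitone (fun T : Finset (ℤ × ℤ) => ind (¬ Arm adj ↑T (Bx m) (Side f N))) := by
    intro f S T hST
    apply ind_mono
    intro h h'
    exact h (h'.mono (by exact_mod_cast hST) subset_rfl subset_rfl)
  have antimul : ∀ f g : Finset (ℤ × ℤ) → ℝ, Antitone f → Antitone g → (∀ T, 0 ≤ f T) →
      (∀ T, 0 ≤ g T) → Antitone (fun T => f T * g T) := by
    intro f g hf hg f0 g0 S T hST
    exact mul_le_mul (hf hST) (hg hST) (g0 T) (f0 S)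
  have k1 := EE_harris h0 h1 (Bx N) (anti (fun v => v.1)) (anti (fun v => -v.1))
  have k2 := EE_harris h0 h1 (Bx N) (anti (fun v => v.2)) (anti (fun v => -v.2))
  have k3 := EE_harris h0 h1 (Bx N)
    (antimul _ _ (anti (fun v => v.1)) (anti (fun v => -v.1)) (fun _ => ind_nonneg _)
      (fun _ => ind_nonneg _))
    (antimul _ _ (anti (fun v => v.2)) (anti (fun v => -v.2)) (fun _ => ind_nonneg _)
      (fun _ => ind_nonneg _))
  have k4 : EE p (Bx N) (fun T => (ind (¬ Arm adj ↑T (Bx m) (Side (fun v => v.1) N)) *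
      ind (¬ Arm adj ↑T (Bx m) (Side (fun v => -v.1) N))) *
      (ind (¬ Arm adj ↑T (Bx m) (Side (fun v => v.2) N)) *
      ind (¬ Arm adj ↑T (Bx m) (Side (fun v => -v.2) N)))) ≤ e ^ 4 := by
    refine le_trans (le_of_eq ?_) h
    apply EE_congr
    intro T _
    rw [← ind_and, ← ind_and, ← ind_and]
    apply ind_congr
    constructor
    · rintro ⟨⟨a1, a2⟩, a3, a4⟩ ⟨a, ha, v, hv, hc⟩
      rw [mem_Lay] at hv
      rcases hv with ⟨hv, h | h | h | h⟩
      · exact a1 ⟨a, ha, v, mem_Side.2 ⟨hv, h⟩, hc⟩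
      · exact a2 ⟨a, ha, v, mem_Side.2 ⟨hv, by omega⟩, hc⟩
      · exact a3 ⟨a, ha, v, mem_Side.2 ⟨hv, h⟩, hc⟩
      · exact a4 ⟨a, ha, v, mem_Side.2 ⟨hv, by omega⟩, hc⟩
    · intro h
      have hs : ∀ f : ℤ × ℤ → ℤ, (∀ v : ℤ × ℤ, f v = N →
          (v.1 = N ∨ v.1 = -N ∨ v.2 = N ∨ v.2 = -N)) → ¬ Arm adj ↑T (Bx m) (Side f N) := by
        intro f hf h'
        apply h
        refine h'.mono subset_rfl subset_rfl ?_
        intro v hv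
        rw [mem_Side] at hv
        exact mem_Lay.2 ⟨hv.1, hf v hv.2⟩
      exact ⟨⟨hs _ (by intro v hv; omega), hs _ (by intro v hv; omega)⟩,
        hs _ (by intro v hv; omega), hs _ (by intro v hv; omega)⟩
  unfold PP at s1 s2 s3 ⊢
  set q := EE p (Bx N) (fun T => ind (¬ Arm adj ↑T (Bx m) (Side (fun v => v.1) N))) with hq
  have hq0 : 0 ≤ q := EE_nonneg h0 h1 fun _ _ => ind_nonneg _
  rw [s1] at k1
  rw [s3, s1, s2] at k2
  have k5 : q ^ 4 ≤ e ^ 4 := by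
    have := mul_le_mul k1 k2 (mul_nonneg hq0 hq0)
      (EE_nonneg h0 h1 fun _ _ => mul_nonneg (ind_nonneg _) (ind_nonneg _))
    calc q ^ 4 = q * q * (q * q) := by ring
      _ ≤ _ := this
      _ ≤ _ := k3
      _ ≤ _ := k4
  have k6 : q ≤ e := (pow_le_pow_iff_left₀ hq0 he (by norm_num)).1 k5
  exact ⟨k6, k6, k6, k6⟩

end Perc

namespace Perc

variable {adj : ℤ × ℤ → ℤ × ℤ → Prop}

/-- The number of classes of sites of `L` under connection in `T`. -/
def clsSetoid (G : GoodAdj adj) (L T : Finset (ℤ × ℤ)) : Setoid ↥L where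
  r v w := v = w ∨ Conn adj ↑T (v : ℤ × ℤ) w
  iseqv := by
    constructor
    · intro v; exact Or.inl rfl
    · rintro v w (h | h)
      · exact Or.inl h.symm
      · exact Or.inr (h.symm G.symm)
    · rintro u v w (rfl | h) (rfl | h')
      · exact Or.inl rfl
      · exact Or.inr h'
      · exact Or.inr h
      · exact Or.inr (h.trans h')

noncomputable def ncls (G : GoodAdj adj) (L T : Finset (ℤ × ℤ)) : ℕ :=
  Nat.card (Quotient (clsSetoid G L T))

def clsMap (G : GoodAdj adj) (L : Finset (ℤ × ℤ)) {T T' : Finset (ℤ × ℤ)} (h : T ⊆ T') :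
    Quotient (clsSetoid G L T) → Quotient (clsSetoid G L T') :=
  Quotient.map' id (by
    rintro v w (h' | h')
    · exact Or.inl h'
    · exact Or.inr (h'.mono (Finset.coe_subset.2 h)))

lemma clsMap_surj (G : GoodAdj adj) (L : Finset (ℤ × ℤ)) {T T' : Finset (ℤ × ℤ)} (h : T ⊆ T') :
    Function.Surjective (clsMap G L h) := by
  intro q
  induction q using Quotient.inductionOn' with
  | h v => exact ⟨Quotient.mk'' v, rfl⟩

lemma ncls_antitone (G : GoodAdj adj) (L : Finset (ℤ × ℤ)) : Antitone (ncls G L) := by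
  intro T T' h
  exact Nat.card_le_card_of_surjective _ (clsMap_surj G L h)

lemma ncls_le (G : GoodAdj adj) (L T : Finset (ℤ × ℤ)) : ncls G L T ≤ L.card := by
  have := Nat.card_le_card_of_surjective (Quotient.mk (clsSetoid G L T)) Quotient.mk_surjective
  simpa [ncls] using this

lemma ncls_lt (G : GoodAdj adj) (L : Finset (ℤ × ℤ)) {T T' : Finset (ℤ × ℤ)} (h : T ⊆ T')
    {v w : ℤ × ℤ} (hv : v ∈ L) (hw : w ∈ L) (hne : v ≠ w) (h1 : ¬ Conn adj ↑T v w)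
    (h2 : Conn adj ↑T' v w) : ncls G L T' + 1 ≤ ncls G L T := by
  classical
  unfold ncls
  have := Fintype.ofFinite (Quotient (clsSetoid G L T))
  have := Fintype.ofFinite (Quotient (clsSetoid G L T'))
  rw [Nat.card_eq_fintype_card, Nat.card_eq_fintype_card]
  refine Fintype.card_lt_of_surjective_not_injective _ (clsMap_surj G L h) ?_
  intro hinj
  have := @hinj (Quotient.mk'' ⟨v, hv⟩) (Quotient.mk'' ⟨w, hw⟩)
    (Quotient.sound' (Or.inr h2))
  rcases Quotient.exact' this with h | h
  · exact hne (by simpa using h)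
  · exact h1 h

lemma box_conn_zero (G : GoodAdj adj) (m : ℕ) : ∀ (k : ℕ) (v : ℤ × ℤ),
    v.1.natAbs + v.2.natAbs = k → v ∈ Bx m → Conn adj ↑(Bx m) 0 v := by
  intro k
  induction k with
  | zero =>
    intro v h hv
    have : v = 0 := by
      ext
      · simp; omega
      · simp; omega
    rw [this]
    exact Conn.refl (zero_mem_Bx m)
  | succ k ih =>
    intro v h hv
    have hv' := hv
    rw [mem_Bx] at hv'
    have key : ∀ u : ℤ × ℤ, u.1.natAbs + u.2.natAbs = k → u ∈ Bx m → Adjacent u v →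
        Conn adj ↑(Bx m) 0 v := fun u hu hum hadj => (ih u hu hum).tail (G.nn _ _ hadj) hv
    rcases lt_trichotomy v.1 0 with h1 | h1 | h1
    · refine key (v.1 + 1, v.2) ?_ ?_ ?_
      · dsimp only; omega
      · rw [mem_Bx]; dsimp only; omega
      · rw [adjacent_iff]; dsimp only; omega
    · rcases lt_trichotomy v.2 0 with h2 | h2 | h2
      · refine key (v.1, v.2 + 1) ?_ ?_ ?_
        · dsimp only; omega
        · rw [mem_Bx]; dsimp only; omega
        · rw [adjacent_iff]; dsimp only; omega
      · omega
      · refine key (v.1, v.2 - 1) ?_ ?_ ?_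
        · dsimp only; omega
        · rw [mem_Bx]; dsimp only; omega
        · rw [adjacent_iff]; dsimp only; omega
    · refine key (v.1 - 1, v.2) ?_ ?_ ?_
      · dsimp only; omega
      · rw [mem_Bx]; dsimp only; omega
      · rw [adjacent_iff]; dsimp only; omega

lemma box_conn (G : GoodAdj adj) (m : ℕ) {v w : ℤ × ℤ} (hv : v ∈ Bx m) (hw : w ∈ Bx m) :
    Conn adj ↑(Bx m) v w :=
  ((box_conn_zero G m _ v rfl hv).symm G.symm).trans (box_conn_zero G m _ w rfl hw)

/-- Two sites of `L` both joined to the block `A` but not to one another. -/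
def Sep (adj : ℤ × ℤ → ℤ × ℤ → Prop) (T : Set (ℤ × ℤ)) (A L : Finset (ℤ × ℤ)) : Prop :=
  ∃ v ∈ L, ∃ w ∈ L, (∃ a ∈ A, Conn adj T a v) ∧ (∃ a ∈ A, Conn adj T a w) ∧ ¬ Conn adj T v w

lemma sep_ncls (G : GoodAdj adj) {T A L : Finset (ℤ × ℤ)}
    (hA : ∀ a ∈ A, ∀ b ∈ A, Conn adj ↑A a b) (h : Sep adj ↑T A L) :
    ncls G L (T ∪ A) + 1 ≤ ncls G L T := by
  obtain ⟨v, hv, w, hw, ⟨a, ha, hav⟩, ⟨b, hb, hbw⟩, hn⟩ := h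
  refine ncls_lt G L Finset.subset_union_left hv hw ?_ hn ?_
  · rintro rfl
    exact hn (Conn.refl hav.mem_right)
  · have i1 : (T : Set (ℤ × ℤ)) ⊆ ↑(T ∪ A) := Finset.coe_subset.2 Finset.subset_union_left
    have i2 : (A : Set (ℤ × ℤ)) ⊆ ↑(T ∪ A) := Finset.coe_subset.2 Finset.subset_union_right
    exact (((hav.symm G.symm).mono i1).trans ((hA a ha b hb).mono i2)).trans (hbw.mono i1)

def shiftE (x : ℤ × ℤ) : ℤ × ℤ ≃ ℤ × ℤ := Equiv.addRight x

lemma shiftE_apply (x v : ℤ × ℤ) : shiftE x v = v + x := rfl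

lemma shiftE_adj (G : GoodAdj adj) (x a b : ℤ × ℤ) : adj (shiftE x a) (shiftE x b) ↔ adj a b :=
  G.shift x a b

/-- total influence -/
noncomputable def Infl (G : GoodAdj adj) (p : ℝ) (N : ℕ) : ℝ :=
  ∑ v ∈ Bx N, EE p (Bx N) (fun T => (ncls G (Lay N) (T.erase v) : ℝ) - ncls G (Lay N) (insert v T))

lemma sep_block (G : GoodAdj adj) {p : ℝ} (h0 : 0 < p) (h1 : p ≤ 1) {m N : ℕ} {x : ℤ × ℤ}
    (hA : (Bx m).map (shiftE x).toEmbedding ⊆ Bx N) :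
    PP p (Bx N) (fun T => Sep adj ↑T ((Bx m).map (shiftE x).toEmbedding) (Lay N)) ≤
      (p⁻¹) ^ (Bx m).card * ∑ u ∈ Bx m, EE p (Bx N) (fun T =>
        (ncls G (Lay N) (T.erase (u + x)) : ℝ) - ncls G (Lay N) (insert (u + x) T)) := by
  set A := (Bx m).map (shiftE x).toEmbedding with hAd
  have hanti : Antitone (fun T => (ncls G (Lay N) T : ℝ)) := by
    intro T T' h
    exact Nat.cast_le.2 (ncls_antitone G (Lay N) h)
  have hAc : ∀ a ∈ A, ∀ b ∈ A, Conn adj ↑A a b := by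
    intro a ha b hb
    rw [hAd, Finset.mem_map] at ha hb
    obtain ⟨a', ha', rfl⟩ := ha
    obtain ⟨b', hb', rfl⟩ := hb
    exact (conn_map (shiftE x) (shiftE_adj G x) _ _ _).2 (box_conn G m ha' hb')
  have := EE_block h0 h1 hanti A hA
  rw [hAd, Finset.card_map, Finset.sum_map] at this
  refine le_trans ?_ this
  refine EE_mono h0.le h1 ?_
  intro T _
  by_cases h : Sep adj ↑T A (Lay N)
  · rw [ind_true h]
    have := sep_ncls G hAc h
    have : (ncls G (Lay N) (T ∪ A) : ℝ) + 1 ≤ ncls G (Lay N) T := by exact_mod_cast this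
    linarith
  · rw [ind_false h]
    have := hanti (Finset.subset_union_left : T ⊆ T ∪ A)
    simp only at this
    linarith

lemma sep_shift (G : GoodAdj adj) {p : ℝ} (h0 : 0 < p) (h1 : p ≤ 1) {m N : ℕ} {x : ℤ × ℤ}
    (hmN : m ≤ N) (hx : x ∈ Bx (N - m)) :
    PP p (Bx (2 * N)) (fun T => Sep adj ↑T (Bx m) (Lay (2 * N))) ≤
    PP p (Bx N) (fun T => Sep adj ↑T ((Bx m).map (shiftE x).toEmbedding) (Lay N)) := by
  rw [mem_Bx] at hx
  have hsub : Bx N ⊆ (Bx (2 * N)).map (shiftE x).toEmbedding := by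
    intro v hv
    rw [Finset.mem_map_equiv]
    rw [mem_Bx] at hv ⊢
    simp only [shiftE, Equiv.addRight_symm, Equiv.coe_addRight, Prod.fst_add, Prod.snd_add,
      Prod.fst_neg, Prod.snd_neg]
    push_cast
    omega
  unfold PP
  rw [← shift_marg p (shiftE x) hsub]
  refine EE_mono h0.le h1 ?_
  intro T hT
  apply ind_mono
  rintro ⟨v, hv, w, hw, ⟨a, ha, hav⟩, ⟨b, hb, hbw⟩, hn⟩
  have reach : ∀ a ∈ Bx m, ∀ v ∈ Lay (2 * N), Conn adj ↑T a v → ∃ v' ∈ Lay N,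
      Conn adj ↑((T.map (shiftE x).toEmbedding) ∩ Bx N) (a + x) v' := by
    intro a ha v hv h
    rw [mem_Bx] at ha
    rw [mem_Lay, mem_Bx] at hv
    have := (conn_map (shiftE x) (shiftE_adj G x) T a v).2 h
    rw [Finset.coe_inter]
    refine reach_layer G this ?_ ?_
    · rw [mem_Bx]
      simp only [Prod.fst_add, Prod.snd_add]
      omega
    · rw [shiftE_apply, mem_Lay, mem_Bx]
      simp only [Prod.fst_add, Prod.snd_add]
      push_cast at hv
      omega
  obtain ⟨v', hv', hv''⟩ := reach a ha v hv hav
  obtain ⟨w', hw', hw''⟩ := reach b hb w hw hbw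
  refine ⟨v', hv', w', hw', ⟨a + x, ?_, hv''⟩, ⟨b + x, ?_, hw''⟩, ?_⟩
  · exact Finset.mem_map.2 ⟨a, ha, rfl⟩
  · exact Finset.mem_map.2 ⟨b, hb, rfl⟩
  · intro hc
    apply hn
    have h1 := (hv''.trans hc).trans (hw''.symm G.symm)
    have h2 : Conn adj ↑(T.map (shiftE x).toEmbedding) (a + x) (b + x) :=
      h1.mono (Finset.coe_subset.2 Finset.inter_subset_left)
    have h3 := (conn_map (shiftE x) (shiftE_adj G x) T a b).1 h2
    exact ((hav.symm G.symm).trans h3).trans hbw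

lemma sep_bound (G : GoodAdj adj) {p : ℝ} (h0 : 0 < p) (h1 : p ≤ 1) {m N : ℕ} (hmN : m ≤ N) :
    (Bx (N - m)).card * PP p (Bx (2 * N)) (fun T => Sep adj ↑T (Bx m) (Lay (2 * N))) ≤
      (p⁻¹) ^ (Bx m).card * (Bx m).card * Infl G p N := by
  have hadd : ∀ x ∈ Bx (N - m), ∀ u ∈ Bx m, u + x ∈ Bx N := by
    intro x hx u hu
    rw [mem_Bx] at hx hu ⊢
    simp only [Prod.fst_add, Prod.snd_add]
    omega
  have step : ∀ x ∈ Bx (N - m),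
      PP p (Bx (2 * N)) (fun T => Sep adj ↑T (Bx m) (Lay (2 * N))) ≤
      (p⁻¹) ^ (Bx m).card * ∑ u ∈ Bx m, EE p (Bx N) (fun T =>
        (ncls G (Lay N) (T.erase (u + x)) : ℝ) - ncls G (Lay N) (insert (u + x) T)) := by
    intro x hx
    refine (sep_shift G h0 h1 hmN hx).trans (sep_block G h0 h1 ?_)
    intro v hv
    rw [Finset.mem_map] at hv
    obtain ⟨u, hu, rfl⟩ := hv
    exact hadd x hx u hu
  have hs := Finset.sum_le_sum step
  rw [Finset.sum_const, nsmul_eq_mul, ← Finset.mul_sum, Finset.sum_comm] at hs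
  refine hs.trans ?_
  rw [mul_assoc]
  apply mul_le_mul_of_nonneg_left _ (by positivity)
  have : ∀ u ∈ Bx m, ∑ x ∈ Bx (N - m), EE p (Bx N) (fun T =>
        (ncls G (Lay N) (T.erase (u + x)) : ℝ) - ncls G (Lay N) (insert (u + x) T)) ≤
        Infl G p N := by
    intro u hu
    unfold Infl
    rw [← Finset.sum_image (s := Bx (N - m)) (g := fun x => u + x)
      (f := fun v => EE p (Bx N) (fun T =>
        (ncls G (Lay N) (T.erase v) : ℝ) - ncls G (Lay N) (insert v T)))
        (by intro a _ b _ h; simpa using h)]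
    apply Finset.sum_le_sum_of_subset_of_nonneg
    · intro v hv
      rw [Finset.mem_image] at hv
      obtain ⟨x, hx, rfl⟩ := hv
      exact hadd x hx u hu
    · intro v _ _
      refine EE_nonneg h0.le h1 ?_
      intro T _
      have := ncls_antitone G (Lay N) ((Finset.erase_subset v T).trans (Finset.subset_insert v T))
      rw [sub_nonneg]
      exact_mod_cast this
  have hs2 := Finset.sum_le_sum this
  rwa [Finset.sum_const, nsmul_eq_mul] at hs2

end Perc

namespace Perc

variable {adj : ℤ × ℤ → ℤ × ℤ → Prop}

lemma card_Bx (N : ℕ) : (Bx N).card = (2 * N + 1) ^ 2 := by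
  unfold Bx
  rw [← Finset.Icc_product_Icc, Finset.card_product, Int.card_Icc]
  have : ((N : ℤ) + 1 - -(N:ℤ)).toNat = 2 * N + 1 := by omega
  rw [this, sq]

lemma card_Lay {N : ℕ} (hN : 1 ≤ N) : (Lay N).card ≤ 8 * N := by
  have hsub : Lay N ⊆ Bx N \ Bx (N - 1) := by
    intro v hv
    rw [mem_Lay] at hv
    rw [Finset.mem_sdiff]
    refine ⟨hv.1, ?_⟩
    rw [mem_Bx]
    omega
  have h := Finset.card_le_card hsub
  rw [Finset.card_sdiff_of_subset (Bx_mono (by omega)), card_Bx, card_Bx] at h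
  obtain ⟨k, rfl⟩ : ∃ k, N = k + 1 := ⟨N - 1, by omega⟩
  have : (2 * (k + 1) + 1) ^ 2 = (2 * (k + 1 - 1) + 1) ^ 2 + 8 * (k + 1) := by
    simp only [Nat.add_sub_cancel]; ring
  omega

/-- expected number of classes -/
noncomputable def FF (G : GoodAdj adj) (N : ℕ) (p : ℝ) : ℝ :=
  EE p (Bx N) (fun T => (ncls G (Lay N) T : ℝ))

lemma FF_deriv (G : GoodAdj adj) (N : ℕ) (p : ℝ) : HasDerivAt (FF G N) (- Infl G p N) p := by
  have h := EE_hasDeriv p (Bx N) (fun T => (ncls G (Lay N) T : ℝ))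
  refine h.congr_deriv ?_
  unfold Infl
  rw [← Finset.sum_neg_distrib]
  refine Finset.sum_congr rfl ?_
  intro v _
  rw [EE_sub, EE_sub]
  ring

lemma FF_nonneg (G : GoodAdj adj) (N : ℕ) {p : ℝ} (h0 : 0 ≤ p) (h1 : p ≤ 1) : 0 ≤ FF G N p :=
  EE_nonneg h0 h1 fun _ _ => Nat.cast_nonneg _

lemma FF_le (G : GoodAdj adj) (N : ℕ) {p : ℝ} (h0 : 0 ≤ p) (h1 : p ≤ 1) :
    FF G N p ≤ (Lay N).card := by
  have := EE_mono h0 h1 (Λ := Bx N) (f := fun T => (ncls G (Lay N) T : ℝ))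
    (g := fun _ => ((Lay N).card : ℝ)) (fun T _ => by
      exact_mod_cast ncls_le G (Lay N) T)
  rwa [EE_const] at this

lemma Infl_nonneg (G : GoodAdj adj) (N : ℕ) {p : ℝ} (h0 : 0 ≤ p) (h1 : p ≤ 1) :
    0 ≤ Infl G p N := by
  refine Finset.sum_nonneg ?_
  intro v _
  refine EE_nonneg h0 h1 ?_
  intro T _
  have := ncls_antitone G (Lay N) ((Finset.erase_subset v T).trans (Finset.subset_insert v T))
  rw [sub_nonneg]
  exact_mod_cast this

lemma exists_good_p {adj' : ℤ × ℤ → ℤ × ℤ → Prop} (G : GoodAdj adj) (G' : GoodAdj adj')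
    {a b : ℝ} (h0 : 0 < a) (hab : a < b) (h1 : b < 1) (N : ℕ) :
    ∃ p, a < p ∧ p < b ∧ Infl G p N ≤ 2 * (Lay N).card / (b - a) ∧
      Infl G' (1 - p) N ≤ 2 * (Lay N).card / (b - a) := by
  have hd : ∀ p : ℝ, HasDerivAt (fun p => FF G' N (1 - p) - FF G N p)
      (Infl G' (1 - p) N + Infl G p N) p := by
    intro p
    have e1 := (FF_deriv G' N (1 - p)).comp p ((hasDerivAt_id p).const_sub 1)
    have e2 := e1.sub (FF_deriv G N p)
    refine e2.congr_deriv ?_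
    ring
  obtain ⟨p, ⟨hp1, hp2⟩, hp⟩ := exists_hasDerivAt_eq_slope (fun p => FF G' N (1 - p) - FF G N p)
    (fun p => Infl G' (1 - p) N + Infl G p N) hab
    (fun p _ => (hd p).continuousAt.continuousWithinAt) (fun p _ => hd p)
  have i1 := Infl_nonneg G N (p := p) (by linarith) (by linarith)
  have i2 := Infl_nonneg G' N (p := 1 - p) (by linarith) (by linarith)
  have b1 := FF_nonneg G N (p := a) (by linarith) (by linarith)
  have b2 := FF_nonneg G N (p := b) (by linarith) (by linarith)
  have b3 := FF_nonneg G' N (p := 1 - a) (by linarith) (by linarith)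
  have c1 := FF_le G N (p := a) (by linarith) (by linarith)
  have c2 := FF_le G' N (p := 1 - b) (by linarith) (by linarith)
  have hle : Infl G' (1 - p) N + Infl G p N ≤ 2 * (Lay N).card / (b - a) := by
    rw [hp]
    apply div_le_div_of_nonneg_right _ (by linarith)
    linarith
  exact ⟨p, hp1, hp2, by linarith, by linarith⟩

lemma sep_small (G : GoodAdj adj) {p a K δ : ℝ} (h0 : 0 < a) (hap : a ≤ p) (h1 : p ≤ 1) {m M N : ℕ}
    (hN : N = M + m) (hM : m + 1 ≤ M)
    (hK : 0 ≤ K) (hI : Infl G p N ≤ K * (Lay N).card) (hδ : 0 < δ)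
    (hbig : (a⁻¹) ^ (Bx m).card * (Bx m).card * K * 16 ≤ δ * M) :
    PP p (Bx (2 * N)) (fun T => Sep adj ↑T (Bx m) (Lay (2 * N))) ≤ δ := by
  have hp0 : 0 < p := by linarith
  have hs := sep_bound G hp0 h1 (m := m) (N := N) (by omega)
  have hNm : N - m = M := by omega
  rw [hNm, card_Bx M] at hs
  have hpa : (p⁻¹) ^ (Bx m).card ≤ (a⁻¹) ^ (Bx m).card := by
    apply pow_le_pow_left₀ (by positivity)
    exact inv_anti₀ h0 hap
  have hL : ((Lay N).card : ℝ) ≤ 16 * M := by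
    have := card_Lay (N := N) (by omega)
    have : (Lay N).card ≤ 16 * M := by omega
    exact_mod_cast this
  have hI0 := Infl_nonneg G N hp0.le h1
  have hMp : (0:ℝ) < M := by
    have : 0 < M := by omega
    exact_mod_cast this
  have e1 : (p⁻¹) ^ (Bx m).card * (Bx m).card * Infl G p N ≤
      (a⁻¹) ^ (Bx m).card * (Bx m).card * (K * (16 * M)) := by
    apply mul_le_mul
    · exact mul_le_mul_of_nonneg_right hpa (Nat.cast_nonneg _)
    · exact hI.trans (mul_le_mul_of_nonneg_left hL hK)
    · exact hI0
    · positivity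
  have e2 : (a⁻¹) ^ (Bx m).card * (Bx m).card * (K * (16 * M)) ≤ δ * M * M := by
    have := mul_le_mul_of_nonneg_right hbig hMp.le
    linarith
  have hD := PP_nonneg hp0.le h1 (Bx (2 * N)) (fun T => Sep adj ↑T (Bx m) (Lay (2 * N)))
  set D := PP p (Bx (2 * N)) (fun T => Sep adj ↑T (Bx m) (Lay (2 * N)))
  push_cast at hs
  have e3 : (M:ℝ) ^ 2 * D ≤ (2 * M + 1) ^ 2 * D := by
    apply mul_le_mul_of_nonneg_right _ hD
    nlinarith
  have e4 : (M:ℝ) ^ 2 * D ≤ M ^ 2 * δ := by nlinarith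
  exact le_of_mul_le_mul_left e4 (by positivity)

/-- failure event -/
def Bad (adj : ℤ × ℤ → ℤ × ℤ → Prop) (f g : ℤ × ℤ → ℤ) (m R : ℕ) (T : Finset (ℤ × ℤ)) : Prop :=
  ¬ Arm adj ↑T (Bx m) (Side f R) ∨ ¬ Arm adj ↑T (Bx m) (Side g R) ∨ Sep adj ↑T (Bx m) (Lay R)

lemma not_bad {f g : ℤ × ℤ → ℤ} {m R : ℕ} {T : Finset (ℤ × ℤ)}
    (hf : Side f R ⊆ Lay R) (hg : Side g R ⊆ Lay R)
    (h : ¬ Bad adj f g m R T) : ∃ v w, f v = R ∧ g w = R ∧ Conn adj ↑T v w := by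
  unfold Bad at h
  push Not at h
  obtain ⟨⟨a, ha, v, hv, hav⟩, ⟨b, hb, w, hw, hbw⟩, h3⟩ := h
  refine ⟨v, w, (mem_Side.1 hv).2, (mem_Side.1 hw).2, ?_⟩
  by_contra hc
  exact h3 ⟨v, hf hv, w, hg hw, ⟨a, ha, hav⟩, ⟨b, hb, hbw⟩, hc⟩

lemma arm_mono_p {p q : ℝ} (h0 : 0 ≤ p) (hpq : p ≤ q) (h1 : q ≤ 1) (Λ A L : Finset (ℤ × ℤ)) :
    PP q Λ (fun T => ¬ Arm adj ↑T A L) ≤ PP p Λ (fun T => ¬ Arm adj ↑T A L) := by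
  rw [PP_not, PP_not]
  have : PP p Λ (fun T => Arm adj ↑T A L) ≤ PP q Λ (fun T => Arm adj ↑T A L) := by
    refine EE_mono_p h0 hpq h1 Λ ?_
    intro S T hST
    exact ind_mono (Arm.mono (Finset.coe_subset.2 hST) subset_rfl subset_rfl)
  linarith

lemma bad_le {p e δ : ℝ} (h0 : 0 ≤ p) (h1 : p ≤ 1) {f g : ℤ × ℤ → ℤ} {m R : ℕ}
    (hf : PP p (Bx R) (fun T => ¬ Arm adj ↑T (Bx m) (Side f R)) ≤ e)
    (hg : PP p (Bx R) (fun T => ¬ Arm adj ↑T (Bx m) (Side g R)) ≤ e)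
    (hs : PP p (Bx R) (fun T => Sep adj ↑T (Bx m) (Lay R)) ≤ δ) :
    PP p (Bx R) (Bad adj f g m R) ≤ 2 * e + δ := by
  unfold Bad
  have := PP_or_le h0 h1 (Bx R) (fun T => ¬ Arm adj ↑T (Bx m) (Side f R))
    (fun T => ¬ Arm adj ↑T (Bx m) (Side g R) ∨ Sep adj ↑T (Bx m) (Lay R))
  have := PP_or_le h0 h1 (Bx R) (fun T => ¬ Arm adj ↑T (Bx m) (Side g R))
    (fun T => Sep adj ↑T (Bx m) (Lay R))
  linarith

lemma coexist {a b c : ℝ} (h0 : 0 < a) (hab : a < b) (h1 : b < 1) (hc : 0 < c)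
    (hA : ∀ N, c ≤ th Adjacent a N) (hK : ∀ N, c ≤ th Kadj (1 - b) N) : False := by
  obtain ⟨m1, hm1⟩ := arms_high goodAdj_adjacent h0.le (by linarith) hc hA
    (ε := (1/10) ^ 4) (by positivity)
  obtain ⟨m2, hm2⟩ := arms_high goodAdj_kadj (p := 1 - b) (by linarith) (by linarith) hc hK
    (ε := (1/10) ^ 4) (by positivity)
  set m := max m1 m2 with hm
  set K : ℝ := 2 / (b - a) with hKd
  have hK0 : 0 ≤ K := by
    have : 0 < b - a := by linarith
    positivity
  obtain ⟨M, hM⟩ := exists_nat_ge (max ((a⁻¹) ^ (Bx m).card * (Bx m).card * K * 16 * 10)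
    (max (((1 - b)⁻¹) ^ (Bx m).card * (Bx m).card * K * 16 * 10) (m + 1)))
  rw [max_le_iff, max_le_iff] at hM
  obtain ⟨hM1, hM2, hM3⟩ := hM
  have hM3 : m + 1 ≤ M := by exact_mod_cast hM3
  obtain ⟨p, hp1, hp2, i1, i2⟩ := exists_good_p goodAdj_adjacent goodAdj_kadj h0 hab h1 (M + m)
  have s1 := sep_small goodAdj_adjacent (p := p) (a := a) (K := K) (δ := 1/10) h0 hp1.le
    (by linarith) (N := M + m) rfl hM3 hK0 (by rw [hKd]; convert i1 using 1; ring) (by norm_num)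
    (by linarith)
  have s2 := sep_small goodAdj_kadj (p := 1 - p) (a := 1 - b) (K := K) (δ := 1/10) (by linarith)
    (by linarith)
    (by linarith) (N := M + m) rfl hM3 hK0 (by rw [hKd]; convert i2 using 1; ring) (by norm_num)
    (by linarith)
  set R := 2 * (M + m) with hR
  have a1 : PP p (Bx R) (fun T => ¬ Arm Adjacent ↑T (Bx m) (Lay R)) ≤ (1/10) ^ 4 := by
    refine (arm_mono_p h0.le hp1.le (by linarith) _ _ _).trans ?_
    refine le_trans ?_ (hm1 R (by omega))
    refine PP_mono h0.le (by linarith) ?_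
    intro T _ hT h
    exact hT (Arm.mono subset_rfl (Bx_mono (le_max_left _ _)) subset_rfl h)
  have a2 : PP (1 - p) (Bx R) (fun T => ¬ Arm Kadj ↑T (Bx m) (Lay R)) ≤ (1/10) ^ 4 := by
    refine (arm_mono_p (p := 1 - b) (by linarith) (by linarith) (by linarith) _ _ _).trans ?_
    refine le_trans ?_ (hm2 R (by omega))
    refine PP_mono (by linarith) (by linarith) ?_
    intro T _ hT h
    exact hT (Arm.mono subset_rfl (Bx_mono (le_max_right _ _)) subset_rfl h)
  obtain ⟨l1, l2, -, -⟩ := side_high goodAdj_adjacent (by linarith) (by linarith) (by norm_num) a1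
  obtain ⟨-, -, l3, l4⟩ := side_high goodAdj_kadj (by linarith) (by linarith) (by norm_num) a2
  have B1 := bad_le (by linarith) (by linarith) l2 l1 s1
  have B2 := bad_le (by linarith) (by linarith) l4 l3 s2
  have B2' : PP p (Bx R) (fun T => Bad Kadj (fun v => -v.2) (fun v => v.2) m R (Bx R \ T)) ≤
      2 * (1/10) + 1/10 := by
    unfold PP
    rw [EE_compl p (Bx R) (fun T => ind (Bad Kadj (fun v => -v.2) (fun v => v.2) m R T))]
    exact B2
  have hor := PP_or_le (p := p) (by linarith) (by linarith) (Bx R)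
    (Bad Adjacent (fun v => -v.1) (fun v => v.1) m R)
    (fun T => Bad Kadj (fun v => -v.2) (fun v => v.2) m R (Bx R \ T))
  have hone : PP p (Bx R) (fun T => Bad Adjacent (fun v => -v.1) (fun v => v.1) m R T ∨
      Bad Kadj (fun v => -v.2) (fun v => v.2) m R (Bx R \ T)) = 1 := by
    unfold PP
    rw [← EE_const p (Bx R) 1]
    refine EE_congr p ?_
    intro T hT
    apply ind_true
    by_contra hcon
    push Not at hcon
    obtain ⟨v, w, hv, hw, hvw⟩ := not_bad
      (by intro v hv; rw [mem_Side] at hv; rw [mem_Lay]; refine ⟨hv.1, ?_⟩; omega)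
      (by intro v hv; rw [mem_Side] at hv; rw [mem_Lay]; refine ⟨hv.1, ?_⟩; omega) hcon.1
    obtain ⟨v', w', hv', hw', hvw'⟩ := not_bad
      (by intro v hv; rw [mem_Side] at hv; rw [mem_Lay]; refine ⟨hv.1, ?_⟩; omega)
      (by intro v hv; rw [mem_Side] at hv; rw [mem_Lay]; refine ⟨hv.1, ?_⟩; omega) hcon.2
    refine no_both (a := -R) (b := R) (c := -R) (d := R) (S := ↑T) (T := ↑(Bx R \ T)) ?_ ?_ ?_
      (by omega) hw hvw (by omega) hw' hvw'
    · rw [Finset.disjoint_coe]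
      exact Finset.disjoint_sdiff
    · intro v hv
      have := hT hv
      rw [mem_Bx] at this
      exact this
    · intro v hv
      have := Finset.sdiff_subset hv
      rw [mem_Bx] at this
      exact this
  linarith

end Perc

namespace Perc

variable {adj : ℤ × ℤ → ℤ × ℤ → Prop}

/-- `v` is a neighbour of the cluster of the origin in `T`. -/
def NbrC (adj : ℤ × ℤ → ℤ × ℤ → Prop) (T : Set (ℤ × ℤ)) (v : ℤ × ℤ) : Prop :=
  ∃ x, adj x v ∧ Conn adj T 0 x

noncomputable def phi (adj : ℤ × ℤ → ℤ × ℤ → Prop) (q : ℝ) (k : ℕ) (S : Finset (ℤ × ℤ)) : ℝ :=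
  ∑ v ∈ Bx (k + 1) \ S, PP q S (fun T => NbrC adj ↑T v)

lemma reach_le (G : GoodAdj adj) {q : ℝ} (h0 : 0 ≤ q) (h1 : q ≤ 1) (Λ : Finset (ℤ × ℤ))
    (y : ℤ × ℤ) (n : ℕ) (h : ∀ v ∈ Bx n, v + y ∈ Λ) :
    PP q Λ (fun T => ∃ v, (v - y ∈ Bx n → v - y ∈ Lay n) ∧ Conn adj ↑T y v) ≤ th adj q n := by
  have hsub : Bx n ⊆ Λ.map (shiftE (-y)).toEmbedding := by
    intro v hv
    rw [Finset.mem_map]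
    exact ⟨v + y, h v hv, by simp [shiftE]⟩
  unfold th PP
  rw [← shift_marg q (shiftE (-y)) hsub]
  refine EE_mono h0 h1 ?_
  intro T hT
  apply ind_mono
  rintro ⟨v, hv, hc⟩
  have hc' := (conn_map (shiftE (-y)) (shiftE_adj G (-y)) T y v).2 hc
  rw [shiftE_apply, shiftE_apply, add_neg_cancel, ← sub_eq_add_neg] at hc'
  rw [Finset.coe_inter]
  exact reach_layer G hc' (zero_mem_Bx n) hv

/-- the cluster of the origin in `T ∩ S` -/
noncomputable def Clu (adj : ℤ × ℤ → ℤ × ℤ → Prop) (S T : Finset (ℤ × ℤ)) : Finset (ℤ × ℤ) := by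
  classical exact S.filter (fun x => Conn adj ↑(T ∩ S) 0 x)

lemma mem_Clu {S T : Finset (ℤ × ℤ)} {x : ℤ × ℤ} :
    x ∈ Clu adj S T ↔ Conn adj ↑(T ∩ S) 0 x := by
  simp only [Clu, Finset.mem_filter]
  constructor
  · exact fun h => h.2
  · intro h
    refine ⟨?_, h⟩
    have := h.mem_right
    rw [Finset.mem_coe, Finset.mem_inter] at this
    exact this.2

/-- closed hull of `C` inside `S` -/
noncomputable def Hull (adj : ℤ × ℤ → ℤ × ℤ → Prop) (S C : Finset (ℤ × ℤ)) : Finset (ℤ × ℤ) := by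
  classical exact S.filter (fun x => x ∈ C ∨ ∃ u ∈ C, adj u x)

lemma mem_Hull {S C : Finset (ℤ × ℤ)} {x : ℤ × ℤ} :
    x ∈ Hull adj S C ↔ x ∈ S ∧ (x ∈ C ∨ ∃ u ∈ C, adj u x) := by
  simp [Hull]

def Valid (adj : ℤ × ℤ → ℤ × ℤ → Prop) (S C : Finset (ℤ × ℤ)) : Prop :=
  (0 : ℤ × ℤ) ∈ C ∧ Clu adj S C = C

lemma Clu_eq {S T C : Finset (ℤ × ℤ)} (hv : Valid adj S C)
    (h : T ∩ Hull adj S C = C) : Clu adj S T = C := by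
  obtain ⟨h0, hC⟩ := hv
  have hCT : C ⊆ T := by rw [← h]; exact Finset.inter_subset_left
  ext x
  constructor
  · intro hx
    rw [mem_Clu] at hx
    refine hx.ind (P := fun x => x ∈ C) h0 ?_
    intro u v _ hu huv hvT
    rw [Finset.mem_coe, Finset.mem_inter] at hvT
    rw [← h, Finset.mem_inter, mem_Hull]
    exact ⟨hvT.1, hvT.2, Or.inr ⟨u, hu, huv⟩⟩
  · intro hx
    rw [← hC, mem_Clu] at hx
    rw [mem_Clu]
    exact hx.mono (Finset.coe_subset.2 (Finset.inter_subset_inter_right hCT))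

lemma Clu_valid {S T : Finset (ℤ × ℤ)} (h0 : (0 : ℤ × ℤ) ∈ T) (hS : (0 : ℤ × ℤ) ∈ S) :
    Valid adj S (Clu adj S T) ∧ T ∩ Hull adj S (Clu adj S T) = Clu adj S T := by
  have hsub : Clu adj S T ⊆ T := by
    intro x hx
    rw [mem_Clu] at hx
    have := hx.mem_right
    rw [Finset.mem_coe, Finset.mem_inter] at this
    exact this.1
  have hz : (0 : ℤ × ℤ) ∈ Clu adj S T := by
    rw [mem_Clu]
    exact Conn.refl (by simp [h0, hS])
  refine ⟨⟨hz, ?_⟩, ?_⟩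
  · ext x
    constructor
    · intro hx
      rw [mem_Clu] at hx
      rw [mem_Clu]
      exact hx.mono (Finset.coe_subset.2 (Finset.inter_subset_inter_right hsub))
    · intro hx
      rw [mem_Clu] at hx
      rw [mem_Clu]
      refine hx.ind (P := fun x => Conn adj ↑(Clu adj S T ∩ S) 0 x)
        (Conn.refl (by simp [hz, hS])) ?_
      intro u v hu hu' huv hvT
      refine hu'.tail huv ?_
      have h2 : v ∈ Clu adj S T := mem_Clu.2 (hu.tail huv hvT)
      rw [Finset.mem_coe, Finset.mem_inter] at hvT ⊢
      exact ⟨h2, hvT.2⟩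
  · ext x
    rw [Finset.mem_inter, mem_Hull]
    constructor
    · rintro ⟨hxT, hxS, hx | ⟨u, hu, hux⟩⟩
      · exact hx
      · rw [mem_Clu] at hu ⊢
        exact hu.tail hux (by simp [hxT, hxS])
    · intro hx
      refine ⟨hsub hx, ?_, Or.inl hx⟩
      rw [mem_Clu] at hx
      have := hx.mem_right
      rw [Finset.mem_coe, Finset.mem_inter] at this
      exact this.2

lemma phi_step (G : GoodAdj adj) {q : ℝ} (h0 : 0 ≤ q) (h1 : q ≤ 1) {L : ℕ} {S : Finset (ℤ × ℤ)}
    (hS : S ⊆ Bx L) (hzS : (0 : ℤ × ℤ) ∈ S) (n : ℕ) :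
    th adj q (n + L + 1) ≤ phi adj q L S * th adj q n := by
  set M := n + L + 1 with hM
  have hSM : S ⊆ Bx M := hS.trans (Bx_mono (by omega))
  -- reduction to a neighbouring site
  have s1 : th adj q M ≤ ∑ y ∈ Bx (L + 1) \ S, PP q (Bx M) (fun T =>
      (0 : ℤ × ℤ) ∈ T ∧ (∃ u ∈ Clu adj S T, adj u y) ∧
        ∃ v ∈ Lay M, Conn adj ↑(T \ Clu adj S T) y v) := by
    refine le_trans ?_ (PP_exists_le h0 h1 (Bx M) _ _)
    refine PP_mono h0 h1 ?_
    rintro T hT ⟨v, hv, hc⟩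
    have hT0 : (0 : ℤ × ℤ) ∈ T := hc.mem_left
    have hz : (0 : ℤ × ℤ) ∈ Clu adj S T := by
      rw [mem_Clu]
      exact Conn.refl (by simp [hT0, hzS])
    have hvC : v ∉ Clu adj S T := by
      intro hvC
      rw [mem_Clu] at hvC
      have := hvC.mem_right
      rw [Finset.mem_coe, Finset.mem_inter] at this
      have := hS this.2
      rw [mem_Bx] at this
      rw [mem_Lay] at hv
      omega
    rcases (hc.symm G.symm).hit ((↑(Clu adj S T) : Set (ℤ × ℤ))ᶜ) (by simpa using hvC) with
      h | ⟨u, u', h, hu', huT, ha⟩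
    · exact absurd hz (by simpa using h.mem_right.2)
    · have hu'C : u' ∈ Clu adj S T := by simpa using hu'
      have huS : u ∉ S := by
        intro huS
        apply h.mem_right.2
        rw [Finset.mem_coe, mem_Clu]
        rw [mem_Clu] at hu'C
        refine hu'C.tail (G.symm _ _ ha) ?_
        rw [Finset.mem_coe, Finset.mem_inter]
        exact ⟨h.mem_right.1, huS⟩
      refine ⟨u, ?_, hT0, ⟨u', hu'C, G.symm _ _ ha⟩, v, hv, ?_⟩
      · rw [Finset.mem_sdiff]
        refine ⟨?_, huS⟩
        rw [mem_Clu] at hu'C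
        have := hu'C.mem_right
        rw [Finset.mem_coe, Finset.mem_inter] at this
        have := hS this.2
        have hk := G.king _ _ ha
        rw [kadj_iff] at hk
        rw [mem_Bx] at this ⊢
        omega
      · refine (h.symm G.symm).mono ?_
        intro z hz
        rw [Finset.coe_sdiff]
        exact hz
  refine s1.trans ?_
  unfold phi
  rw [Finset.sum_mul]
  refine Finset.sum_le_sum ?_
  intro y hy
  rw [Finset.mem_sdiff] at hy
  -- bound of the second factor
  have hreach : ∀ A : Finset (ℤ × ℤ),
      PP q (Bx M \ A) (fun T => ∃ v ∈ Lay M, Conn adj ↑T y v) ≤ th adj q n := by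
    intro A
    unfold PP
    rw [← EE_marg' q A (Bx M) (fun T => ind (∃ v ∈ Lay M, Conn adj ↑T y v))]
    refine le_trans ?_ (reach_le G h0 h1 (Bx M) y n ?_)
    · refine EE_mono h0 h1 ?_
      intro T _
      apply ind_mono
      rintro ⟨v, hv, hc⟩
      refine ⟨v, ?_, hc.mono (Finset.coe_subset.2 Finset.sdiff_subset)⟩
      have hy1 := hy.1
      rw [mem_Bx] at hy1
      rw [mem_Lay] at hv
      rw [mem_Lay, mem_Bx]
      simp only [Prod.fst_sub, Prod.snd_sub]
      omega
    · intro v hv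
      have hy1 := hy.1
      rw [mem_Bx] at hv hy1 ⊢
      simp only [Prod.fst_add, Prod.snd_add]
      omega
  have s2 : PP q (Bx M) (fun T =>
      (0 : ℤ × ℤ) ∈ T ∧ (∃ u ∈ Clu adj S T, adj u y) ∧
        ∃ v ∈ Lay M, Conn adj ↑(T \ Clu adj S T) y v) ≤
      EE q (Bx M) (fun T => ∑ C ∈ S.powerset,
        (ind (T ∩ Hull adj S C = C) * ind (Valid adj S C ∧ ∃ u ∈ C, adj u y)) *
          ind (∃ v ∈ Lay M, Conn adj ↑(T \ Hull adj S C) y v)) := by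
    refine EE_mono h0 h1 ?_
    intro T _
    have hnn : ∀ C ∈ S.powerset, 0 ≤
        (ind (T ∩ Hull adj S C = C) * ind (Valid adj S C ∧ ∃ u ∈ C, adj u y)) *
          ind (∃ v ∈ Lay M, Conn adj ↑(T \ Hull adj S C) y v) := fun C _ =>
      mul_nonneg (mul_nonneg (ind_nonneg _) (ind_nonneg _)) (ind_nonneg _)
    by_cases h : (0 : ℤ × ℤ) ∈ T ∧ (∃ u ∈ Clu adj S T, adj u y) ∧
        ∃ v ∈ Lay M, Conn adj ↑(T \ Clu adj S T) y v
    · rw [ind_true h]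
      obtain ⟨hT0, hu, v, hv, hc⟩ := h
      obtain ⟨hV, hH⟩ := Clu_valid (adj := adj) hT0 hzS
      have hmem : Clu adj S T ∈ S.powerset := by
        rw [Finset.mem_powerset]
        intro x hx
        rw [mem_Clu] at hx
        have := hx.mem_right
        rw [Finset.mem_coe, Finset.mem_inter] at this
        exact this.2
      refine le_trans ?_ (Finset.single_le_sum hnn hmem)
      have hsd : T \ Hull adj S (Clu adj S T) = T \ Clu adj S T := by
        conv_rhs => rw [← hH]
        rw [Finset.sdiff_inter_self_left]
      rw [ind_true hH, ind_true ⟨hV, hu⟩, hsd, ind_true ⟨v, hv, hc⟩]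
      norm_num
    · rw [ind_false h]
      exact Finset.sum_nonneg hnn
  refine s2.trans ?_
  rw [EE_sum]
  have s3 : ∀ C ∈ S.powerset, EE q (Bx M) (fun T =>
        (ind (T ∩ Hull adj S C = C) * ind (Valid adj S C ∧ ∃ u ∈ C, adj u y)) *
          ind (∃ v ∈ Lay M, Conn adj ↑(T \ Hull adj S C) y v)) ≤
      EE q S (fun T => ind (T ∩ Hull adj S C = C) * ind (Valid adj S C ∧ ∃ u ∈ C, adj u y))
        * th adj q n := by
    intro C _
    have hHS : Hull adj S C ⊆ S := fun x hx => (mem_Hull.1 hx).1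
    rw [EE_indep q (hHS.trans hSM)
      (fun T => ind (T = C) * ind (Valid adj S C ∧ ∃ u ∈ C, adj u y))
      (fun T => ind (∃ v ∈ Lay M, Conn adj ↑T y v)),
      EE_marg q hHS (fun T => ind (T = C) * ind (Valid adj S C ∧ ∃ u ∈ C, adj u y))]
    refine mul_le_mul_of_nonneg_left (hreach _) ?_
    exact EE_nonneg h0 h1 fun _ _ => mul_nonneg (ind_nonneg _) (ind_nonneg _)
  refine (Finset.sum_le_sum s3).trans ?_
  rw [← Finset.sum_mul, ← EE_sum]
  refine mul_le_mul_of_nonneg_right ?_ (th_nonneg h0 h1 n)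
  refine EE_mono h0 h1 ?_
  intro T hT
  have hterm : ∀ C ∈ S.powerset, C ≠ Clu adj S T →
      ind (T ∩ Hull adj S C = C) * ind (Valid adj S C ∧ ∃ u ∈ C, adj u y) = 0 := by
    intro C _ hC
    rw [← ind_and]
    apply ind_false
    rintro ⟨hH, hV, _⟩
    exact hC (Clu_eq hV hH).symm
  have hmem : Clu adj S T ∈ S.powerset := by
    rw [Finset.mem_powerset]
    intro x hx
    rw [mem_Clu] at hx
    have := hx.mem_right
    rw [Finset.mem_coe, Finset.mem_inter] at this
    exact this.2
  rw [Finset.sum_eq_single_of_mem _ hmem hterm, ← ind_and]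
  apply ind_mono
  rintro ⟨_, _, u, hu, huy⟩
  rw [mem_Clu] at hu
  exact ⟨u, huy, hu.mono (Finset.coe_subset.2 Finset.inter_subset_left)⟩

end Perc

namespace Perc

variable {adj : ℤ × ℤ → ℤ × ℤ → Prop}

/-- `z` is joined to the boundary layer in `T`. -/
def Bd (adj : ℤ × ℤ → ℤ × ℤ → Prop) (n : ℕ) (T : Set (ℤ × ℤ)) (z : ℤ × ℤ) : Prop :=
  ∃ w ∈ Lay n, Conn adj T z w

lemma Bd.step (G : GoodAdj adj) {n : ℕ} {T : Set (ℤ × ℤ)} {u v : ℤ × ℤ} (h : Bd adj n T u)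
    (ha : adj v u) (hv : v ∈ T) : Bd adj n T v := by
  obtain ⟨w, hw, hc⟩ := h
  exact ⟨w, hw, ((Conn.refl hv).tail ha hc.mem_left).trans hc⟩

/-- sites of the box not on the layer, and not in or next to the boundary cluster -/
noncomputable def SS (adj : ℤ × ℤ → ℤ × ℤ → Prop) (n : ℕ) (T : Finset (ℤ × ℤ)) :
    Finset (ℤ × ℤ) := by
  classical exact (Bx n).filter (fun z => z ∉ Lay n ∧ ¬ Bd adj n ↑T z ∧ ∀ b, Bd adj n ↑T b →
    ¬ adj z b)

lemma mem_SS {n : ℕ} {T : Finset (ℤ × ℤ)} {z : ℤ × ℤ} : z ∈ SS adj n T ↔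
    z ∈ Bx n ∧ z ∉ Lay n ∧ ¬ Bd adj n ↑T z ∧ ∀ b, Bd adj n ↑T b → ¬ adj z b := by
  simp only [SS, Finset.mem_filter]

lemma SS_eq_of_Bd {n : ℕ} {T T' : Finset (ℤ × ℤ)} (h : ∀ z, Bd adj n ↑T z ↔ Bd adj n ↑T' z) :
    SS adj n T = SS adj n T' := by
  ext z
  rw [mem_SS, mem_SS]
  simp only [h]

lemma SS_local (G : GoodAdj adj) {n : ℕ} {T S : Finset (ℤ × ℤ)} :
    SS adj n T = S ↔ SS adj n (T \ S) = S := by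
  constructor
  · intro h
    rw [← SS_eq_of_Bd (T := T)]
    · exact h
    · intro z
      constructor
      · rintro ⟨w, hw, hc⟩
        have hb : Bd adj n ↑T w := ⟨w, hw, Conn.refl hc.mem_right⟩
        have nS : ∀ x, Bd adj n ↑T x → x ∉ S := by
          intro x hx hxS
          rw [← h, mem_SS] at hxS
          exact hxS.2.2.1 hx
        refine ⟨w, hw, Conn.symm G.symm ?_⟩
        have hc' := hc.symm G.symm
        have := hc'.ind (P := fun z => Conn adj ↑(T \ S) w z) (Conn.refl ?_) ?_
        · exact this
        · rw [Finset.mem_coe, Finset.mem_sdiff]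
          exact ⟨hc.mem_right, nS w hb⟩
        · intro u v hu ih huv hv
          refine ih.tail huv ?_
          rw [Finset.mem_coe, Finset.mem_sdiff]
          exact ⟨hv, nS v ⟨w, hw, ((hu.tail huv hv).symm G.symm)⟩⟩
      · rintro ⟨w, hw, hc⟩
        exact ⟨w, hw, hc.mono (Finset.coe_subset.2 Finset.sdiff_subset)⟩
  · intro h
    rw [SS_eq_of_Bd (T' := T \ S)]
    · exact h
    · intro z
      constructor
      · rintro ⟨w, hw, hc⟩
        have hc' := hc.symm G.symm
        refine hc'.ind (P := fun z => Bd adj n ↑(T \ S) z) ⟨w, hw, Conn.refl ?_⟩ ?_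
        · rw [Finset.mem_coe, Finset.mem_sdiff]
          refine ⟨hc.mem_right, ?_⟩
          intro hwS
          rw [← h, mem_SS] at hwS
          exact hwS.2.1 hw
        · intro u v _ ih huv hv
          refine ih.step G (G.symm _ _ huv) ?_
          rw [Finset.mem_coe, Finset.mem_sdiff]
          refine ⟨hv, ?_⟩
          intro hvS
          rw [← h, mem_SS] at hvS
          exact hvS.2.2.2 u ih (G.symm _ _ huv)
      · rintro ⟨w, hw, hc⟩
        exact ⟨w, hw, hc.mono (Finset.coe_subset.2 Finset.sdiff_subset)⟩

/-- pivotality from the cluster of the origin -/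
lemma piv_of_nbr (G : GoodAdj adj) {n : ℕ} {T S : Finset (ℤ × ℤ)} (h : SS adj n T = S)
    {v : ℤ × ℤ} (hvB : v ∈ Bx n) (hvS : v ∉ S) (hn : NbrC adj ↑(T ∩ S) v) :
    Bd adj n ↑(insert v T) 0 := by
  obtain ⟨x, hxv, hc⟩ := hn
  have hxS : x ∈ S := by
    have := hc.mem_right
    rw [Finset.mem_coe, Finset.mem_inter] at this
    exact this.2
  have i1 : ((T ∩ S : Finset (ℤ × ℤ)) : Set (ℤ × ℤ)) ⊆ ↑(insert v T) :=
    Finset.coe_subset.2 (Finset.inter_subset_left.trans (Finset.subset_insert _ _))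
  have hcv : Conn adj ↑(insert v T) 0 v := (hc.mono i1).tail hxv (by simp)
  rw [← h, mem_SS] at hxS
  by_cases hvL : v ∈ Lay n
  · exact ⟨v, hvL, hcv⟩
  · have : ∃ b, Bd adj n ↑T b ∧ adj v b := by
      by_contra hcon
      push Not at hcon
      apply hvS
      rw [← h, mem_SS]
      refine ⟨hvB, hvL, fun hb => hxS.2.2.2 v hb hxv, hcon⟩
    obtain ⟨b, ⟨w, hw, hbw⟩, hvb⟩ := this
    have hbw' : Conn adj ↑(insert v T) b w :=
      hbw.mono (Finset.coe_subset.2 (Finset.subset_insert _ _))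
    exact ⟨w, hw, (hcv.tail hvb hbw'.mem_left).trans hbw'⟩

lemma phi_mono {q p : ℝ} (h0 : 0 ≤ q) (hqp : q ≤ p) (h1 : p ≤ 1) (k : ℕ) (S : Finset (ℤ × ℤ)) :
    phi adj q k S ≤ phi adj p k S := by
  refine Finset.sum_le_sum ?_
  intro v _
  refine EE_mono_p h0 hqp h1 S ?_
  intro T T' h
  apply ind_mono
  rintro ⟨x, hx, hc⟩
  exact ⟨x, hx, hc.mono (Finset.coe_subset.2 h)⟩

lemma deriv_ge (G : GoodAdj adj) {p : ℝ} (h0 : 0 ≤ p) (h1 : p ≤ 1) (k : ℕ)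
    (hphi : ∀ S ⊆ Bx k, (0 : ℤ × ℤ) ∈ S → 1 ≤ phi adj p k S) :
    1 - th adj p (k + 1) ≤ ∑ v ∈ Bx (k + 1), EE p (Bx (k + 1)) (fun T =>
      ind (Bd adj (k + 1) ↑(insert v T) 0) - ind (Bd adj (k + 1) ↑(T.erase v) 0)) := by
  set n := k + 1 with hn
  set Λ := Bx n with hΛ
  set Z : Finset (Finset (ℤ × ℤ)) := (Bx k).powerset.filter (fun S => (0 : ℤ × ℤ) ∈ S) with hZ
  have hpos : ∀ (v : ℤ × ℤ) (T : Finset (ℤ × ℤ)),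
      0 ≤ ind (Bd adj n ↑(insert v T) 0) - ind (Bd adj n ↑(T.erase v) 0) := by
    intro v T
    rw [sub_nonneg]
    apply ind_mono
    rintro ⟨w, hw, hc⟩
    exact ⟨w, hw, hc.mono (Finset.coe_subset.2
      ((Finset.erase_subset _ _).trans (Finset.subset_insert _ _)))⟩
  have hpiv : ∀ (v : ℤ × ℤ) (T : Finset (ℤ × ℤ)), ¬ Bd adj n ↑T 0 → Bd adj n ↑(insert v T) 0 →
      ind (Bd adj n ↑(insert v T) 0) - ind (Bd adj n ↑(T.erase v) 0) = 1 := by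
    intro v T hT hvT
    rw [ind_true hvT, ind_false]
    · norm_num
    · rintro ⟨w, hw, hc⟩
      exact hT ⟨w, hw, hc.mono (Finset.coe_subset.2 (Finset.erase_subset _ _))⟩
  have hSk : ∀ T, SS adj n T ⊆ Bx k := by
    intro T z hz
    rw [mem_SS, mem_Lay, mem_Bx] at hz
    rw [mem_Bx]
    omega
  -- pointwise lower bound
  have hpt : ∀ T, T ⊆ Λ →
      (∑ S ∈ Z, ind (SS adj n (T \ S) = S) * ∑ v ∈ Λ \ S, ind (NbrC adj ↑(T ∩ S) v)) +
        ind (¬ Bd adj n ↑T 0 ∧ (0 : ℤ × ℤ) ∉ SS adj n T) ≤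
      ∑ v ∈ Λ, (ind (Bd adj n ↑(insert v T) 0) - ind (Bd adj n ↑(T.erase v) 0)) := by
    intro T hT
    have hzero : ∀ S ∈ Z, S ≠ SS adj n T →
        ind (SS adj n (T \ S) = S) * ∑ v ∈ Λ \ S, ind (NbrC adj ↑(T ∩ S) v) = 0 := by
      intro S _ hS
      rw [ind_false, zero_mul]
      intro h
      exact hS ((SS_local G).2 h).symm
    by_cases hz : (0 : ℤ × ℤ) ∈ SS adj n T
    · have hmem : SS adj n T ∈ Z := by
        rw [hZ, Finset.mem_filter, Finset.mem_powerset]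
        exact ⟨hSk T, hz⟩
      rw [Finset.sum_eq_single_of_mem _ hmem hzero, ind_true ((SS_local G).1 rfl), one_mul,
        ind_false (by tauto), add_zero]
      have hnB : ¬ Bd adj n ↑T 0 := (mem_SS.1 hz).2.2.1
      refine le_trans (Finset.sum_le_sum (g := fun v =>
        ind (Bd adj n ↑(insert v T) 0) - ind (Bd adj n ↑(T.erase v) 0)) ?_)
        (Finset.sum_le_sum_of_subset_of_nonneg Finset.sdiff_subset fun v _ _ => hpos v T)
      intro v hv
      rw [Finset.mem_sdiff] at hv
      by_cases hN : NbrC adj ↑(T ∩ SS adj n T) v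
      · rw [ind_true hN, hpiv v T hnB (piv_of_nbr G rfl hv.1 hv.2 hN)]
      · rw [ind_false hN]
        exact hpos v T
    · have : ∑ S ∈ Z, ind (SS adj n (T \ S) = S) * ∑ v ∈ Λ \ S, ind (NbrC adj ↑(T ∩ S) v) = 0 := by
        refine Finset.sum_eq_zero ?_
        intro S hS
        refine hzero S hS ?_
        rintro rfl
        rw [hZ, Finset.mem_filter] at hS
        exact hz hS.2
      rw [this, zero_add]
      by_cases hB : Bd adj n ↑T 0
      · rw [ind_false (by tauto)]
        exact Finset.sum_nonneg fun v _ => hpos v T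
      · rw [ind_true ⟨hB, hz⟩]
        have hzL : (0 : ℤ × ℤ) ∉ Lay n := by
          rw [mem_Lay]
          simp only [Prod.fst_zero, Prod.snd_zero]
          omega
        have : ∃ b, Bd adj n ↑T b ∧ adj 0 b := by
          by_contra hcon
          push Not at hcon
          apply hz
          rw [mem_SS]
          exact ⟨zero_mem_Bx n, hzL, hB, hcon⟩
        obtain ⟨b, ⟨w, hw, hbw⟩, h0b⟩ := this
        have hbw' : Conn adj ↑(insert 0 T) b w :=
          hbw.mono (Finset.coe_subset.2 (Finset.subset_insert _ _))
        have hp := hpiv 0 T hB ⟨w, hw, ((Conn.refl (by simp)).tail h0b hbw'.mem_left).trans hbw'⟩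
        rw [← hp]
        exact Finset.single_le_sum (f := fun v =>
          ind (Bd adj n ↑(insert v T) 0) - ind (Bd adj n ↑(T.erase v) 0))
          (fun v _ => hpos v T) (zero_mem_Bx n)
  rw [← EE_sum]
  refine le_trans ?_ (EE_mono h0 h1 hpt)
  rw [EE_add, EE_sum]
  have hterm : ∀ S ∈ Z, PP p Λ (fun T => SS adj n T = S) ≤ EE p Λ (fun T =>
      ind (SS adj n (T \ S) = S) * ∑ v ∈ Λ \ S, ind (NbrC adj ↑(T ∩ S) v)) := by
    intro S hS
    rw [hZ, Finset.mem_filter, Finset.mem_powerset] at hS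
    have hSΛ : S ⊆ Λ := hS.1.trans (Bx_mono (by omega))
    have e1 : EE p Λ (fun T =>
      ind (SS adj n (T \ S) = S) * ∑ v ∈ Λ \ S, ind (NbrC adj ↑(T ∩ S) v)) =
      EE p S (fun T => ∑ v ∈ Λ \ S, ind (NbrC adj ↑T v)) *
        EE p (Λ \ S) (fun T => ind (SS adj n T = S)) := by
      rw [← EE_indep p hSΛ]
      exact EE_congr p fun T _ => mul_comm _ _
    rw [e1, EE_sum, ← EE_marg' p S Λ (fun T => ind (SS adj n T = S))]
    have e2 : EE p Λ (fun T => ind (SS adj n (T \ S) = S)) = PP p Λ (fun T => SS adj n T = S) :=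
      EE_congr p fun T _ => ind_congr (SS_local G).symm
    rw [e2]
    have := hphi S hS.1 hS.2
    have hnn := PP_nonneg h0 h1 Λ (fun T => SS adj n T = S)
    unfold phi at this
    exact le_mul_of_one_le_left hnn this
  refine le_trans ?_ (add_le_add_left (Finset.sum_le_sum hterm) _)
  unfold PP
  rw [← EE_sum, ← EE_add]
  have e3 : 1 - th adj p n = PP p Λ (fun T => ¬ Bd adj n ↑T 0) := by
    rw [PP_not]; rfl
  rw [e3]
  refine EE_mono h0 h1 ?_
  intro T _
  by_cases hB : Bd adj n ↑T 0
  · rw [ind_false (by tauto)]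
    exact add_nonneg (Finset.sum_nonneg fun _ _ => ind_nonneg _) (ind_nonneg _)
  · rw [ind_true hB]
    by_cases hz : (0 : ℤ × ℤ) ∈ SS adj n T
    · have hmem : SS adj n T ∈ Z := by
        rw [hZ, Finset.mem_filter, Finset.mem_powerset]
        exact ⟨hSk T, hz⟩
      have := Finset.single_le_sum (f := fun S => ind (SS adj n T = S))
        (fun _ _ => ind_nonneg _) hmem
      simp only [ind_true] at this
      have := ind_nonneg (¬ Bd adj n ↑T 0 ∧ (0 : ℤ × ℤ) ∉ SS adj n T)
      linarith
    · rw [ind_true (show ¬ Bd adj n ↑T 0 ∧ (0 : ℤ × ℤ) ∉ SS adj n T from ⟨hB, hz⟩)]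
      have : 0 ≤ ∑ S ∈ Z, ind (SS adj n T = S) := Finset.sum_nonneg fun _ _ => ind_nonneg _
      linarith

lemma th_mono_p {p q : ℝ} (h0 : 0 ≤ p) (hpq : p ≤ q) (h1 : q ≤ 1) (n : ℕ) :
    th adj p n ≤ th adj q n := by
  refine EE_mono_p h0 hpq h1 _ ?_
  intro T T' h
  apply ind_mono
  rintro ⟨x, hx, hc⟩
  exact ⟨x, hx, hc.mono (Finset.coe_subset.2 h)⟩

lemma th_anti (G : GoodAdj adj) {p : ℝ} (h0 : 0 ≤ p) (h1 : p ≤ 1) {m n : ℕ} (h : m < n) :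
    th adj p n ≤ th adj p m := by
  have := arms_step G h0 h1 (m := m) (N := n) h
  have := mul_nonneg (th_nonneg (adj := adj) h0 h1 m)
    (PP_nonneg h0 h1 (Bx n) (fun T => ¬ Arm adj ↑T (Bx (m+1)) (Lay n)))
  linarith

lemma th_lower (G : GoodAdj adj) {q q' : ℝ} (h0 : 0 ≤ q) (hqq : q < q') (h1 : q' ≤ 1)
    (hphi : ∀ k, ∀ S ⊆ Bx k, (0 : ℤ × ℤ) ∈ S → 1 ≤ phi adj q k S) (n : ℕ) :
    (q' - q) / 2 ≤ th adj q' n := by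
  have main : ∀ k, (q' - q) / 2 ≤ th adj q' (k + 1) := by
    intro k
    have hd : ∀ p : ℝ, HasDerivAt (fun p => th adj p (k + 1)) _ p := fun p =>
      EE_hasDeriv p (Bx (k + 1)) (fun T => ind (Bd adj (k + 1) ↑T 0))
    obtain ⟨p, ⟨hp1, hp2⟩, hp⟩ := exists_hasDerivAt_eq_slope (fun p => th adj p (k + 1))
      _ hqq (fun p _ => (hd p).continuousAt.continuousWithinAt) (fun p _ => hd p)
    have hp0 : 0 ≤ p := by linarith
    have hge := deriv_ge G hp0 (by linarith) k (fun S hS hz =>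
      (hphi k S hS hz).trans (phi_mono h0 hp1.le (by linarith) k S))
    rw [hp, le_div_iff₀ (by linarith)] at hge
    have m1 := th_mono_p (adj := adj) hp0 hp2.le h1 (k + 1)
    have m2 := th_nonneg (adj := adj) h0 (by linarith) (k + 1)
    have m3 := th_nonneg (adj := adj) (h0.trans hqq.le) h1 (k + 1)
    nlinarith
  rcases n with _ | k
  · exact (main 0).trans (th_anti G (by linarith) h1 (by omega))
  · exact main k

lemma th_decay (G : GoodAdj adj) {q : ℝ} (h0 : 0 ≤ q) (h1 : q ≤ 1) {L : ℕ} {S : Finset (ℤ × ℤ)}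
    (hS : S ⊆ Bx L) (hzS : (0 : ℤ × ℤ) ∈ S) (hphi : phi adj q L S < 1) :
    ∃ r : ℝ, 0 < r ∧ r < 1 ∧ ∀ j : ℕ, th adj q (j * (L + 1)) ≤ r ^ j := by
  refine ⟨max (phi adj q L S) (1/2), by positivity, by
    rw [max_lt_iff]; exact ⟨hphi, by norm_num⟩, ?_⟩
  intro j
  induction j with
  | zero =>
    rw [pow_zero]
    exact PP_le_one h0 h1 _ _
  | succ j ih =>
    have := phi_step G h0 h1 hS hzS (j * (L + 1))
    have e : (j + 1) * (L + 1) = j * (L + 1) + L + 1 := by ring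
    rw [e, pow_succ']
    refine this.trans ?_
    exact mul_le_mul (le_max_left _ _) ih (th_nonneg h0 h1 _) (by positivity)

end Perc

namespace Perc

lemma measure_event {p : ℝ} (h0 : 0 ≤ p) (h1 : p ≤ 1) {μ : Measure Config}
    (hμ : IsBernoulliProduct p μ) (Λ : Finset (ℤ × ℤ)) (P : Finset (ℤ × ℤ) → Prop) :
    μ {ω : Config | P (Λ.filter (fun v => ω v = true))} = ENNReal.ofReal (PP p Λ P) := by
  classical
  have hset : {ω : Config | P (Λ.filter (fun v => ω v = true))} =
      ⋃ T ∈ Λ.powerset.filter P, {ω : Config | ∀ v ∈ Λ, ω v = decide (v ∈ T)} := by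
    ext ω
    simp only [Set.mem_ofPred_eq, Set.mem_iUnion, Finset.mem_filter, Finset.mem_powerset,
      exists_prop]
    constructor
    · intro h
      refine ⟨Λ.filter (fun v => ω v = true), ⟨Finset.filter_subset _ _, h⟩, ?_⟩
      intro v hv
      cases hω : ω v <;> simp [hv, hω]
    · rintro ⟨T, ⟨hT, hP⟩, hω⟩
      have : Λ.filter (fun v => ω v = true) = T := by
        ext v
        rw [Finset.mem_filter]
        constructor
        · rintro ⟨hv, hv'⟩
          rw [hω v hv] at hv'
          simpa using hv'
        · intro hv
          refine ⟨hT hv, ?_⟩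
          rw [hω v (hT hv)]
          simpa using hv
      rw [this]
      exact hP
  rw [hset, measure_biUnion_finset]
  · have hT : ∀ T ∈ Λ.powerset.filter P, μ {ω : Config | ∀ v ∈ Λ, ω v = decide (v ∈ T)} =
        ENNReal.ofReal (p ^ T.card * (1 - p) ^ (Λ \ T).card) := by
      intro T hT
      rw [Finset.mem_filter, Finset.mem_powerset] at hT
      rw [hμ.2 Λ (fun v => decide (v ∈ T)), ← ENNReal.ofReal_prod_of_nonneg]
      · congr 1
        simp only [decide_eq_true_eq]
        rw [Finset.prod_ite, Finset.prod_const, Finset.prod_const,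
          Finset.filter_mem_eq_inter, Finset.inter_eq_right.2 hT.1]
        congr 3
        ext v
        simp
      · intro v _
        split_ifs <;> linarith
    rw [Finset.sum_congr rfl hT, ← ENNReal.ofReal_sum_of_nonneg]
    · congr 1
      unfold PP EE
      rw [Finset.sum_filter]
      refine Finset.sum_congr rfl ?_
      intro T _
      beta_reduce
      by_cases h : P T
      · rw [if_pos h, ind_true h, mul_one]
      · rw [if_neg h, ind_false h, mul_zero]
    · intro T _
      have : 0 ≤ 1 - p := by linarith
      positivity
  · intro T hT T' hT' hne
    rw [Function.onFun, Set.disjoint_left]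
    intro ω h h'
    apply hne
    rw [Finset.mem_coe, Finset.mem_filter, Finset.mem_powerset] at hT hT'
    ext v
    constructor
    · intro hv
      have := (h v (hT.1 hv)).symm.trans (h' v (hT.1 hv))
      simpa [hv] using this
    · intro hv
      have := (h v (hT'.1 hv)).symm.trans (h' v (hT'.1 hv))
      simpa [hv] using this
  · intro T _
    have : {ω : Config | ∀ v ∈ Λ, ω v = decide (v ∈ T)} =
        ⋂ v ∈ Λ, (fun ω : Config => ω v) ⁻¹' {decide (v ∈ T)} := by
      ext ω; simp
    rw [this]
    refine Finset.measurableSet_biInter _ ?_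
    intro v _
    exact measurable_pi_apply v (MeasurableSet.singleton _)

lemma openConn_conn {ω : Config} {S : Set (ℤ × ℤ)} {v w : ℤ × ℤ} (hv : ω v = true) (hS : v ∈ S) :
    OpenConn ω S v w ↔ Conn Adjacent ({x | ω x = true} ∩ S) v w := by
  unfold OpenConn Conn
  constructor
  · intro h
    exact ⟨⟨hv, hS⟩, Relation.ReflTransGen.mono (fun a b h => ⟨h.1, h.2.2, h.2.1⟩) _ _ h⟩
  · intro h
    exact Relation.ReflTransGen.mono (fun a b h => ⟨h.1, h.2.2, h.2.1⟩) _ _ h.2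

lemma pc_nonneg : 0 ≤ siteCriticalProbability :=
  Real.sSup_nonneg fun _ hx => hx.1.1

lemma th_of_supercritical {a : ℝ} (h : siteCriticalProbability < a) (h1 : a ≤ 1) :
    ∃ c : ℝ, 0 < c ∧ ∀ N, c ≤ th Adjacent a N := by
  have h0 : 0 ≤ a := pc_nonneg.trans h.le
  have : ∃ μ : Measure Config, IsBernoulliProduct a μ ∧
      μ {ω | (cluster ω Set.univ (0, 0)).Infinite} ≠ 0 := by
    by_contra hcon
    push Not at hcon
    refine absurd (le_csSup ?_ ?_ : a ≤ siteCriticalProbability) (not_le.2 h)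
    · exact ⟨1, fun x hx => hx.1.2⟩
    · exact ⟨⟨h0, h1⟩, hcon⟩
  obtain ⟨μ, hμ, hne⟩ := this
  have := hμ.1
  refine ⟨(μ {ω | (cluster ω Set.univ (0, 0)).Infinite}).toReal,
    ENNReal.toReal_pos hne (measure_ne_top _ _), ?_⟩
  intro N
  refine ENNReal.toReal_le_of_le_ofReal (th_nonneg h0 h1 N) ?_
  unfold th
  rw [← measure_event h0 h1 hμ]
  refine measure_mono ?_
  intro ω hω
  obtain ⟨y, hy, hyN⟩ := Set.Infinite.exists_notMem_finset hω (Bx N)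
  obtain ⟨_, hω0, hc⟩ := hy
  rw [openConn_conn hω0 (Set.mem_univ _)] at hc
  obtain ⟨v, hv, hc'⟩ := reach_layer goodAdj_adjacent hc (zero_mem_Bx N) (fun h => absurd h hyN)
  refine ⟨v, hv, hc'.mono ?_⟩
  rintro x ⟨⟨hx, _⟩, hxN⟩
  rw [Finset.mem_coe, Finset.mem_filter]
  exact ⟨hxN, hx⟩

/-- crossing of `box0 n` by the set `T` -/
def Cross (n : ℕ) (T : Finset (ℤ × ℤ)) : Prop :=
  ∃ u u' : ℤ × ℤ, u.1 = 0 ∧ u'.1 = 0 + (n : ℤ) ∧ Conn Adjacent (↑T ∩ box0 n) u u'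

lemma box0_sub {n : ℕ} {v : ℤ × ℤ} (hv : v ∈ box0 n) : v ∈ Bx (2 * n) := by
  unfold box0 at hv
  rw [Set.mem_ofPred_eq] at hv
  rw [mem_Bx]
  push_cast
  omega

lemma crossing_eq (n : ℕ) :
    CrossingEvent n = {ω : Config | Cross n ((Bx (2 * n)).filter (fun v => ω v = true))} := by
  ext ω
  have hset : (↑((Bx (2 * n)).filter (fun v => ω v = true)) ∩ box0 n : Set (ℤ × ℤ)) =
      {x | ω x = true} ∩ box0 n := by
    ext x
    simp only [Finset.coe_filter, Set.mem_inter_iff, Set.mem_ofPred_eq]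
    constructor
    · rintro ⟨⟨_, h⟩, h'⟩; exact ⟨h, h'⟩
    · rintro ⟨h, h'⟩; exact ⟨⟨box0_sub h', h⟩, h'⟩
  unfold CrossingEvent Cross
  simp only [Set.mem_ofPred_eq]
  rw [hset]
  constructor
  · rintro ⟨v, hv, hv0, hω, w, hw, hwn, hc⟩
    exact ⟨v, w, hv0, by rw [hwn]; ring, (openConn_conn hω hv).1 hc⟩
  · rintro ⟨v, w, hv0, hwn, hc⟩
    have hv := hc.mem_left
    exact ⟨v, hv.2, hv0, hv.1, w, hc.mem_right.2, by rw [hwn]; ring,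
      (openConn_conn hv.1 hv.2).2 hc⟩

lemma not_cross {n : ℕ} {T : Finset (ℤ × ℤ)} (h : ¬ Cross n T) :
    ∃ w w' : ℤ × ℤ, w.2 = 0 ∧ w'.2 = (n : ℤ) ∧ Conn Kadj ((↑T : Set (ℤ × ℤ))ᶜ ∩ box0 n) w w' := by
  refine dual_exists 0 0 n n (by omega) ↑T (box0 n) ?_ h
  intro v
  unfold box0
  rw [Set.mem_ofPred_eq, zero_add]

lemma cross_full (n : ℕ) : Cross n (Bx (2 * n)) := by
  by_contra h
  obtain ⟨w, w', _, _, hc⟩ := not_cross h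
  exact hc.mem_left.1 (box0_sub hc.mem_left.2)

lemma cross_pos {p : ℝ} (h0 : 0 < p) (h1 : p ≤ 1) (n : ℕ) :
    0 < PP p (Bx (2 * n)) (Cross n) := by
  have hnn : ∀ T ∈ (Bx (2 * n)).powerset,
      0 ≤ p ^ T.card * (1 - p) ^ (Bx (2 * n) \ T).card * ind (Cross n T) := by
    intro T _
    have : 0 ≤ 1 - p := by linarith
    have := ind_nonneg (Cross n T)
    positivity
  have := Finset.single_le_sum hnn (Finset.mem_powerset.2 (subset_refl (Bx (2 * n))))
  rw [ind_true (cross_full n), sdiff_self, Finset.bot_eq_empty, Finset.card_empty] at this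
  refine lt_of_lt_of_le ?_ this
  positivity

lemma not_cross_le {p : ℝ} (h0 : 0 ≤ p) (h1 : p ≤ 1) (n : ℕ) :
    1 - PP p (Bx (2 * n)) (Cross n) ≤ (n + 1) * th Kadj (1 - p) n := by
  have hq0 : 0 ≤ 1 - p := by linarith
  have hq1 : 1 - p ≤ 1 := by linarith
  rw [← PP_not]
  set row : Finset (ℤ × ℤ) := (Finset.Icc (0:ℤ) n) ×ˢ {(0:ℤ)} with hrow
  have hmem : ∀ y ∈ row, 0 ≤ y.1 ∧ y.1 ≤ n ∧ y.2 = 0 := by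
    intro y hy
    rw [hrow, Finset.mem_product, Finset.mem_Icc, Finset.mem_singleton] at hy
    exact ⟨hy.1.1, hy.1.2, hy.2⟩
  have s1 : PP p (Bx (2 * n)) (fun T => ¬ Cross n T) ≤ PP p (Bx (2 * n)) (fun T =>
      ∃ y ∈ row, ∃ v, (v - y ∈ Bx n → v - y ∈ Lay n) ∧ Conn Kadj ↑(Bx (2 * n) \ T) y v) := by
    refine PP_mono h0 h1 ?_
    intro T _ hT
    obtain ⟨w, w', hw, hw', hc⟩ := not_cross hT
    have hwb := hc.mem_left.2
    unfold box0 at hwb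
    rw [Set.mem_ofPred_eq] at hwb
    refine ⟨w, ?_, w', ?_, hc.mono ?_⟩
    · rw [hrow, Finset.mem_product, Finset.mem_Icc, Finset.mem_singleton]
      exact ⟨⟨hwb.1, hwb.2.1⟩, hw⟩
    · intro h
      rw [mem_Lay]
      refine ⟨h, ?_⟩
      simp only [Prod.snd_sub]
      omega
    · rintro x ⟨hx, hx'⟩
      rw [Finset.mem_coe, Finset.mem_sdiff]
      exact ⟨box0_sub hx', hx⟩
  refine s1.trans ?_
  have s2 : PP p (Bx (2 * n)) (fun T =>
      ∃ y ∈ row, ∃ v, (v - y ∈ Bx n → v - y ∈ Lay n) ∧ Conn Kadj ↑(Bx (2 * n) \ T) y v) =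
      PP (1 - p) (Bx (2 * n)) (fun T =>
      ∃ y ∈ row, ∃ v, (v - y ∈ Bx n → v - y ∈ Lay n) ∧ Conn Kadj ↑T y v) :=
    EE_compl p (Bx (2 * n)) (fun T => ind (∃ y ∈ row, ∃ v, (v - y ∈ Bx n → v - y ∈ Lay n) ∧
      Conn Kadj ↑T y v))
  rw [s2]
  refine (PP_exists_le hq0 hq1 _ row _).trans ?_
  refine (Finset.sum_le_sum (g := fun _ => th Kadj (1 - p) n) ?_).trans ?_
  · intro y hy
    refine reach_le goodAdj_kadj hq0 hq1 _ y n ?_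
    intro v hv
    have := hmem y hy
    rw [mem_Bx] at hv ⊢
    simp only [Prod.fst_add, Prod.snd_add]
    push_cast
    omega
  · rw [Finset.sum_const, nsmul_eq_mul, hrow, Finset.card_product, Int.card_Icc,
      Finset.card_singleton]
    apply le_of_eq
    congr 1
    have : ((n : ℤ) + 1 - 0).toNat * 1 = n + 1 := by omega
    rw [this]
    push_cast
    rfl

lemma dual_decay {p : ℝ} (hpc : siteCriticalProbability < p) (h1 : p ≤ 1) :
    ∃ (L : ℕ) (r : ℝ), 0 < r ∧ r < 1 ∧ ∀ j : ℕ, th Kadj (1 - p) (j * (L + 1)) ≤ r ^ j := by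
  have hp0 : 0 ≤ siteCriticalProbability := pc_nonneg
  by_cases h : ∀ k, ∀ S ⊆ Bx k, (0 : ℤ × ℤ) ∈ S → 1 ≤ phi Kadj (1 - p) k S
  · exfalso
    set s := siteCriticalProbability
    obtain ⟨c, hc, hA⟩ := th_of_supercritical (a := (2 * s + p) / 3) (by linarith) (by linarith)
    have hK := th_lower goodAdj_kadj (q := 1 - p) (q' := 1 - (s + 2 * p) / 3) (by linarith)
      (by linarith) (by linarith) h
    refine coexist (a := (2 * s + p) / 3) (b := (s + 2 * p) / 3) (c := min c
      ((1 - (s + 2 * p) / 3 - (1 - p)) / 2)) (by linarith) (by linarith) (by linarith)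
      (lt_min hc (by linarith)) ?_ ?_
    · exact fun N => (min_le_left _ _).trans (hA N)
    · exact fun N => (min_le_right _ _).trans (hK N)
  · push Not at h
    obtain ⟨k, S, hS, hz, hphi⟩ := h
    obtain ⟨r, hr⟩ := th_decay goodAdj_kadj (by linarith) (by linarith) hS hz hphi
    exact ⟨k, r, hr⟩

lemma choose_const (x : ℕ → ℝ) {B c : ℝ} (hB : 0 < B) (hc : 0 < c) (hx : ∀ n, 1 ≤ n → x n < 1)
    (hxB : ∀ n : ℕ, 1 ≤ n → x n ≤ n * (B * Real.exp (-c * n))) :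
    ∃ C : ℝ, 0 < C ∧ ∀ n : ℕ, 1 ≤ n → x n ≤ n * Real.exp (-C * n) := by
  obtain ⟨n0, hn0⟩ := exists_nat_ge (2 * Real.log B / c)
  have hev : ∀ᶠ C : ℝ in nhdsWithin 0 (Set.Ioi 0), ∀ n ∈ Finset.Icc 1 n0,
      x n ≤ n * Real.exp (-C * n) := by
    rw [Filter.eventually_all_finset]
    intro n hn
    rw [Finset.mem_Icc] at hn
    have hcont : Filter.Tendsto (fun C : ℝ => (n:ℝ) * Real.exp (-C * n)) (nhdsWithin 0 (Set.Ioi 0))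
        (nhds (n * Real.exp (-0 * n))) := by
      apply Filter.Tendsto.mono_left _ nhdsWithin_le_nhds
      exact Continuous.tendsto (by fun_prop) 0
    have hlt : x n < n * Real.exp (-0 * n) := by
      have : (1:ℝ) ≤ n := by exact_mod_cast hn.1
      have := hx n hn.1
      simp
      linarith
    filter_upwards [hcont.eventually_const_lt hlt] with C hC using hC.le
  have hev2 : ∀ᶠ C : ℝ in nhdsWithin 0 (Set.Ioi 0), C < c / 2 := by
    apply mem_nhdsWithin_of_mem_nhds
    exact Iio_mem_nhds (by linarith)
  obtain ⟨C, ⟨h1, h2⟩, h3⟩ := ((hev.and hev2).and self_mem_nhdsWithin).exists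
  refine ⟨C, h3, ?_⟩
  intro n hn
  by_cases hnn : n ≤ n0
  · exact h1 n (Finset.mem_Icc.2 ⟨hn, hnn⟩)
  · refine (hxB n hn).trans ?_
    apply mul_le_mul_of_nonneg_left _ (Nat.cast_nonneg _)
    rw [← Real.exp_log hB, ← Real.exp_add, Real.exp_le_exp]
    have h4 : (n0 : ℝ) ≤ n := by exact_mod_cast (not_le.1 hnn).le
    have h5 : 2 * Real.log B / c ≤ n := hn0.trans h4
    rw [div_le_iff₀ hc] at h5
    have h6 : C * n ≤ c / 2 * n := mul_le_mul_of_nonneg_right h2.le (Nat.cast_nonneg _)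
    linarith

lemma final_bound {p : ℝ} (hpc : siteCriticalProbability < p) (h1 : p ≤ 1) :
    ∃ C : ℝ, 0 < C ∧ ∀ n : ℕ, 1 ≤ n →
      1 - PP p (Bx (2 * n)) (Cross n) ≤ n * Real.exp (-C * n) := by
  have hp0 : 0 < p := lt_of_le_of_lt pc_nonneg hpc
  obtain ⟨L, r, hr0, hr1, hr⟩ := dual_decay hpc h1
  have hlog : Real.log r < 0 := Real.log_neg hr0 hr1
  have hK : (0:ℝ) < (L:ℝ) + 1 := by positivity
  refine choose_const (fun n => 1 - PP p (Bx (2 * n)) (Cross n)) (B := 2 * Real.exp (-Real.log r))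
    (c := -Real.log r / (L + 1)) (by positivity) (div_pos (by linarith) hK) ?_ ?_
  · intro n _
    have := cross_pos hp0 h1 n
    linarith
  · intro n hn
    have hn1 : (1:ℝ) ≤ n := by exact_mod_cast hn
    have hq0 : 0 ≤ 1 - p := by linarith
    have hq1 : 1 - p ≤ 1 := by linarith
    have e1 := not_cross_le hp0.le h1 n
    have hth : th Kadj (1 - p) n ≤ r ^ (n / (L + 1)) := by
      refine le_trans ?_ (hr (n / (L + 1)))
      rcases (Nat.div_mul_le_self n (L + 1)).lt_or_eq with h | h
      · exact th_anti goodAdj_kadj hq0 hq1 h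
      · rw [h]
    have hexp : r ^ (n / (L + 1)) ≤
        Real.exp (-Real.log r) * Real.exp (-(-Real.log r / (L + 1)) * n) := by
      rw [← Real.exp_add, ← Real.rpow_natCast, Real.rpow_def_of_pos hr0, Real.exp_le_exp]
      have hlt : n < (n / (L + 1) + 1) * (L + 1) := by
        have := Nat.lt_div_mul_add (a := n) (b := L + 1) (by omega)
        linarith
      have hlt' : (n:ℝ) ≤ (((n / (L + 1) : ℕ) : ℝ) + 1) * (L + 1) := by exact_mod_cast hlt.le
      have hdiv : (n:ℝ) / (L + 1) ≤ ((n / (L + 1) : ℕ) : ℝ) + 1 := by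
        rw [div_le_iff₀ hK]
        exact hlt'
      have e : -(-Real.log r / ((L:ℝ) + 1)) * n = Real.log r * ((n:ℝ) / (L + 1)) := by
        ring
      rw [e]
      nlinarith
    have hthn := th_nonneg (adj := Kadj) hq0 hq1 n
    have hX := hth.trans hexp
    set X := Real.exp (-Real.log r) * Real.exp (-(-Real.log r / (L + 1)) * n)
    calc 1 - PP p (Bx (2 * n)) (Cross n) ≤ (n + 1) * th Kadj (1 - p) n := e1
      _ ≤ (2 * n) * X := by
        apply mul_le_mul (by linarith) hX hthn (by positivity)
      _ = _ := by ring

end Perc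

/-- Consider site percolation on `ℤ²` with parameter `p` satisfying
`p_c < p ≤ 1`. Let `A_n` be the event that there is an open left-right crossing of the box
`{0,…,n} × {0,…,n}`. Then there exists a constant `C₄ = C₄(p) > 0` such that for all
integers `n ≥ 1`, `P_p(A_n) ≥ 1 − n·exp(−C₄·n)`. -/
theorem crossing_probability_bound (p : ℝ) (hpc : siteCriticalProbability < p) (hp1 : p ≤ 1)
    (μ : Measure Config) (hμ : IsBernoulliProduct p μ) :
    ∃ C₄ : ℝ, 0 < C₄ ∧ ∀ n : ℕ, 1 ≤ n →
      ENNReal.ofReal (1 - n * Real.exp (-C₄ * n)) ≤ μ (CrossingEvent n) := by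
  obtain ⟨C, hC, h⟩ := Perc.final_bound hpc hp1
  refine ⟨C, hC, ?_⟩
  intro n hn
  have hp0 : 0 ≤ p := Perc.pc_nonneg.trans hpc.le
  rw [Perc.crossing_eq, Perc.measure_event hp0 hp1 hμ]
  refine ENNReal.ofReal_le_ofReal ?_
  have := h n hn
  linarith
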